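/- Proposition 4.1: Let n ≥ 2 and l, k ≥ 1. Let ι : B_l ⊗ B_k → B_k ⊗ B_l be any isomorphism of U_q'(C_n^(1)) crystals and let H be any energy function for ι. Suppose b_1 ⊗ b_2 ∈ B_l ⊗ B_k satisfies ẽ_i(b_1 ⊗ b_2) = 0 for all 1 ≤ i ≤ n (it is a U_q(C_n) highest element), and suppose x_0(b_1) = 0 or x_0(b_2) = 0. Write ι(b_1 ⊗ b_2) = b'_2 ⊗ b'_1. Then x_0(b'_2) = 0 or x_0(b'_1) = 0; the two column insertions give a common tableau, (𝕋(b_2) → 𝕋(b_1)) = (𝕋(b'_1) → 𝕋(b'_2)); and H(b_1 ⊗ b_2) equals the length of the first row of (𝕋(b_2) → 𝕋(b_1)) minus max(l, k). -/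

import Mathlib

namespace KTT

/-- Raw data of a crystal element `(x_1,…,x_n,x̄_n,…,x̄_1)`:
`b.1 i` is `x_{i+1}` and `b.2 i` is `x̄_{i+1}` for `i : Fin n`. -/
abbrev Tup (n : ℕ) := (Fin n → ℕ) × (Fin n → ℕ)

/-- The entry `x_j` (for `1 ≤ j ≤ n`). -/
def xc {n : ℕ} (b : Tup n) (j : ℕ) : ℕ :=
  if h : j - 1 < n then b.1 ⟨j - 1, h⟩ else 0

/-- The entry `x̄_j` (for `1 ≤ j ≤ n`). -/
def xbc {n : ℕ} (b : Tup n) (j : ℕ) : ℕ :=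
  if h : j - 1 < n then b.2 ⟨j - 1, h⟩ else 0

/-- Set the entry indexed by `j` (i.e. `x_j`) to the value `v`. -/
def setx {n : ℕ} (f : Fin n → ℕ) (j v : ℕ) : Fin n → ℕ :=
  fun t => if (t : ℕ) + 1 = j then v else f t

/-- `Σ_{i=1}^n (x_i + x̄_i)`. -/
def tsum {n : ℕ} (b : Tup n) : ℕ := ∑ i, (b.1 i + b.2 i)

/-- The element `(v,0,…,0)`. -/
def uvec (n v : ℕ) : Tup n := (fun j => if (j : ℕ) = 0 then v else 0, fun _ => 0)

/-- The element `(0,v,---,0)` (only `x_2 = v` nonzero). -/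
def u2vec (n v : ℕ) : Tup n := (fun j => if (j : ℕ) = 1 then v else 0, fun _ => 0)

/-- The element `(0,0,---,v)` (only `x̄_1 = v` nonzero). -/
def barvec (n v : ℕ) : Tup n := (fun _ => 0, fun j => if (j : ℕ) = 0 then v else 0)

/-- The element `(a,c,---,d)` with `x_1 = a`, `x_2 = c`, `x̄_1 = d`, all else `0`. -/
def tripleVec (n a c d : ℕ) : Tup n :=
  (fun j => if (j : ℕ) = 0 then a else if (j : ℕ) = 1 then c else 0,
   fun j => if (j : ℕ) = 0 then d else 0)

/-! ### The `U_q'(C_n^{(1)})` crystal `B_l` -/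

/-- Membership in the `C_n^{(1)}` crystal `B_l` : the sum of the entries belongs to
`{l, l-2, l-4, …}`. -/
def memC (n l : ℕ) (b : Tup n) : Prop := tsum b ≤ l ∧ (l - tsum b) % 2 = 0

def BC (n l : ℕ) : Set (Tup n) := {b | memC n l b}

/-- The number `x_0(b)` of `(0,0̄)` pairs. -/
def x0 (l : ℕ) {n : ℕ} (b : Tup n) : ℕ := (l - tsum b) / 2

/-- The operator `ẽ_i` on `B_l` (C case); `none` plays the role of `0`. -/
def eC (n l i : ℕ) (b : Tup n) : Option (Tup n) :=
  if i = 0 then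
    if 0 < n then
      if xbc b 1 + 2 ≤ xc b 1 then some (setx b.1 1 (xc b 1 - 2), b.2)
      else if xc b 1 = xbc b 1 + 1 then
        some (setx b.1 1 (xc b 1 - 1), setx b.2 1 (xbc b 1 + 1))
      else if tsum b + 2 ≤ l then some (b.1, setx b.2 1 (xbc b 1 + 2))
      else none
    else none
  else if i = n then
    if 0 < xbc b n then some (setx b.1 n (xc b n + 1), setx b.2 n (xbc b n - 1))
    else none
  else if i < n then
    if xbc b (i + 1) < xc b (i + 1) then
      some (setx (setx b.1 i (xc b i + 1)) (i + 1) (xc b (i + 1) - 1), b.2)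
    else if 0 < xbc b i then
      some (b.1, setx (setx b.2 (i + 1) (xbc b (i + 1) + 1)) i (xbc b i - 1))
    else none
  else none

/-- The operator `f̃_i` on `B_l` (C case). -/
def fC (n l i : ℕ) (b : Tup n) : Option (Tup n) :=
  if i = 0 then
    if 0 < n then
      if xbc b 1 ≤ xc b 1 then
        if tsum b + 2 ≤ l then some (setx b.1 1 (xc b 1 + 2), b.2) else none
      else if xc b 1 + 1 = xbc b 1 then
        some (setx b.1 1 (xc b 1 + 1), setx b.2 1 (xbc b 1 - 1))
      else some (b.1, setx b.2 1 (xbc b 1 - 2))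
    else none
  else if i = n then
    if 0 < xc b n then some (setx b.1 n (xc b n - 1), setx b.2 n (xbc b n + 1))
    else none
  else if i < n then
    if xbc b (i + 1) ≤ xc b (i + 1) then
      if 0 < xc b i then
        some (setx (setx b.1 i (xc b i - 1)) (i + 1) (xc b (i + 1) + 1), b.2)
      else none
    else some (b.1, setx (setx b.2 (i + 1) (xbc b (i + 1) - 1)) i (xbc b i + 1))
  else none

def eCIter (n l i m : ℕ) (b : Tup n) : Option (Tup n) :=
  (fun o => Option.bind o (eC n l i))^[m] (some b)

def fCIter (n l i m : ℕ) (b : Tup n) : Option (Tup n) :=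
  (fun o => Option.bind o (fC n l i))^[m] (some b)

/-- `ε_i(b) = max {m | ẽ_i^m b ≠ 0}` (C case). -/
noncomputable def epsC (n l i : ℕ) (b : Tup n) : ℕ :=
  sSup {m | eCIter n l i m b ≠ none}

/-- `φ_i(b) = max {m | f̃_i^m b ≠ 0}` (C case). -/
noncomputable def phiC (n l i : ℕ) (b : Tup n) : ℕ :=
  sSup {m | fCIter n l i m b ≠ none}

/-- `ẽ_i` on the tensor product `B_l ⊗ B_k` (C case). -/
noncomputable def eTenC (n l k i : ℕ) (u : Tup n × Tup n) : Option (Tup n × Tup n) :=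
  if epsC n k i u.2 ≤ phiC n l i u.1 then (eC n l i u.1).map (fun c => (c, u.2))
  else (eC n k i u.2).map (fun c => (u.1, c))

/-- `f̃_i` on the tensor product `B_l ⊗ B_k` (C case). -/
noncomputable def fTenC (n l k i : ℕ) (u : Tup n × Tup n) : Option (Tup n × Tup n) :=
  if epsC n k i u.2 < phiC n l i u.1 then (fC n l i u.1).map (fun c => (c, u.2))
  else (fC n k i u.2).map (fun c => (u.1, c))

/-- `ι : B_l ⊗ B_k → B_k ⊗ B_l` is an isomorphism of `U_q'(C_n^{(1)})` crystals. -/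
def IsIsoC (n l k : ℕ) (ι : Tup n × Tup n → Tup n × Tup n) : Prop :=
  Set.BijOn ι (BC n l ×ˢ BC n k) (BC n k ×ˢ BC n l) ∧
  ∀ u ∈ BC n l ×ˢ BC n k, ∀ i ≤ n,
    Option.map ι (eTenC n l k i u) = eTenC n k l i (ι u) ∧
    Option.map ι (fTenC n l k i u) = fTenC n k l i (ι u)

/-- `H` is an energy function for the isomorphism `ι` (C case), normalized by
`H((l,0,…,0) ⊗ (0,k,---,0)) = 0`. -/
def IsEnergyC (n l k : ℕ) (ι : Tup n × Tup n → Tup n × Tup n)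
    (H : Tup n × Tup n → ℤ) : Prop :=
  (∀ u ∈ BC n l ×ˢ BC n k, ∀ i ≤ n, ∀ v, eTenC n l k i u = some v →
      H v = H u +
        (if i = 0 then
          (if epsC n k 0 u.2 ≤ phiC n l 0 u.1 ∧ epsC n l 0 (ι u).2 ≤ phiC n k 0 (ι u).1
           then 1
           else if phiC n l 0 u.1 < epsC n k 0 u.2 ∧ phiC n k 0 (ι u).1 < epsC n l 0 (ι u).2
           then -1 else 0)
         else 0)) ∧
  H (uvec n l, u2vec n k) = 0

/-! ### The `U_q'(A_{2n-1}^{(2)})` crystal `B_l` -/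

def memA (n l : ℕ) (b : Tup n) : Prop := tsum b = l

def BA (n l : ℕ) : Set (Tup n) := {b | memA n l b}

/-- The operator `ẽ_i` (A case). -/
def eA (n i : ℕ) (b : Tup n) : Option (Tup n) :=
  if i = 0 then
    if 1 < n then
      if xbc b 2 < xc b 2 then some (setx b.1 2 (xc b 2 - 1), setx b.2 1 (xbc b 1 + 1))
      else if 0 < xc b 1 then some (setx b.1 1 (xc b 1 - 1), setx b.2 2 (xbc b 2 + 1))
      else none
    else none
  else if i = n then
    if 0 < xbc b n then some (setx b.1 n (xc b n + 1), setx b.2 n (xbc b n - 1))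
    else none
  else if i < n then
    if xbc b (i + 1) < xc b (i + 1) then
      some (setx (setx b.1 i (xc b i + 1)) (i + 1) (xc b (i + 1) - 1), b.2)
    else if 0 < xbc b i then
      some (b.1, setx (setx b.2 (i + 1) (xbc b (i + 1) + 1)) i (xbc b i - 1))
    else none
  else none

/-- The operator `f̃_i` (A case). -/
def fA (n i : ℕ) (b : Tup n) : Option (Tup n) :=
  if i = 0 then
    if 1 < n then
      if xbc b 2 ≤ xc b 2 then
        if 0 < xbc b 1 then some (setx b.1 2 (xc b 2 + 1), setx b.2 1 (xbc b 1 - 1))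
        else none
      else some (setx b.1 1 (xc b 1 + 1), setx b.2 2 (xbc b 2 - 1))
    else none
  else if i = n then
    if 0 < xc b n then some (setx b.1 n (xc b n - 1), setx b.2 n (xbc b n + 1))
    else none
  else if i < n then
    if xbc b (i + 1) ≤ xc b (i + 1) then
      if 0 < xc b i then
        some (setx (setx b.1 i (xc b i - 1)) (i + 1) (xc b (i + 1) + 1), b.2)
      else none
    else some (b.1, setx (setx b.2 (i + 1) (xbc b (i + 1) - 1)) i (xbc b i + 1))
  else none

def eAIter (n i m : ℕ) (b : Tup n) : Option (Tup n) :=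
  (fun o => Option.bind o (eA n i))^[m] (some b)

def fAIter (n i m : ℕ) (b : Tup n) : Option (Tup n) :=
  (fun o => Option.bind o (fA n i))^[m] (some b)

noncomputable def epsA (n i : ℕ) (b : Tup n) : ℕ :=
  sSup {m | eAIter n i m b ≠ none}

noncomputable def phiA (n i : ℕ) (b : Tup n) : ℕ :=
  sSup {m | fAIter n i m b ≠ none}

/-- `ẽ_i` on a tensor product (A case). -/
noncomputable def eTenA (n i : ℕ) (u : Tup n × Tup n) : Option (Tup n × Tup n) :=
  if epsA n i u.2 ≤ phiA n i u.1 then (eA n i u.1).map (fun c => (c, u.2))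
  else (eA n i u.2).map (fun c => (u.1, c))

/-- `f̃_i` on a tensor product (A case). -/
noncomputable def fTenA (n i : ℕ) (u : Tup n × Tup n) : Option (Tup n × Tup n) :=
  if epsA n i u.2 < phiA n i u.1 then (fA n i u.1).map (fun c => (c, u.2))
  else (fA n i u.2).map (fun c => (u.1, c))

/-- `ι : B_l ⊗ B_k → B_k ⊗ B_l` is an isomorphism of `U_q'(A_{2n-1}^{(2)})` crystals. -/
def IsIsoA (n l k : ℕ) (ι : Tup n × Tup n → Tup n × Tup n) : Prop :=
  Set.BijOn ι (BA n l ×ˢ BA n k) (BA n k ×ˢ BA n l) ∧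
  ∀ u ∈ BA n l ×ˢ BA n k, ∀ i ≤ n,
    Option.map ι (eTenA n i u) = eTenA n i (ι u) ∧
    Option.map ι (fTenA n i u) = fTenA n i (ι u)

/-- `H` is an energy function for `ι` (A case), normalized by
`H((l,0,…,0) ⊗ (0,0,---,k)) = 0`. -/
def IsEnergyA (n l k : ℕ) (ι : Tup n × Tup n → Tup n × Tup n)
    (H : Tup n × Tup n → ℤ) : Prop :=
  (∀ u ∈ BA n l ×ˢ BA n k, ∀ i ≤ n, ∀ v, eTenA n i u = some v →
      H v = H u +
        (if i = 0 then
          (if epsA n 0 u.2 ≤ phiA n 0 u.1 ∧ epsA n 0 (ι u).2 ≤ phiA n 0 (ι u).1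
           then 1
           else if phiA n 0 u.1 < epsA n 0 u.2 ∧ phiA n 0 (ι u).1 < epsA n 0 (ι u).2
           then -1 else 0)
         else 0)) ∧
  H (uvec n l, barvec n k) = 0

/-! ### Words, tableaux and column insertion

Letters are encoded as natural numbers: the unbarred letter `j` (for `0 ≤ j ≤ n`) is `j`,
and the barred letter `j̄` is `2n+1-j`; the natural order of `ℕ` is the order
`0 < 1 < ⋯ < n < n̄ < ⋯ < 1̄ < 0̄`.  A (two-row) tableau is encoded as the list of its
columns (left to right), each column being the list of its entries (top to bottom). -/

/-- The barred partner `j̄` of an unbarred letter `j`. -/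
def bar (n j : ℕ) : ℕ := 2 * n + 1 - j

/-- Column insertion of a letter into a tableau with at most two rows. -/
def insertLetter (n : ℕ) : ℕ → List (List ℕ) → List (List ℕ)
  | a, [] => [[a]]
  | a, [p] :: rest =>
      if a ≤ p then [a] :: insertLetter n p rest else [p, a] :: rest
  | a, [p, q] :: rest =>
      if p ≠ 0 ∧ p ≤ n ∧ q = bar n p ∧ p ≤ a ∧ a ≤ q then
        -- the column is a pair `(x, x̄)` with `x ≠ 0` and `x ≤ a ≤ x̄`
        [p - 1, a] :: insertLetter n (bar n (p - 1)) rest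
      else if n + 1 ≤ q ∧ bar n q < p ∧ p < q ∧ a = bar n q ∧ q ≠ n + 1 then
        -- the column is `(β, x̄)` with `x < β < x̄`, `a = x` and `x ≠ n`
        [a + 1, bar n (a + 1)] :: insertLetter n p rest
      else if a ≤ p then [a, q] :: insertLetter n p rest
      else if a ≤ q then [p, a] :: insertLetter n q rest
      else [p, q, a] :: rest
  | a, C :: rest => (C ++ [a]) :: rest

/-- Column insertion of a word `u = u_1 ⋯ u_j` into a tableau: `u_j` first, `u_1` last. -/
def insertWord (n : ℕ) (u : List ℕ) (T : List (List ℕ)) : List (List ℕ) :=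
  u.foldr (fun a T => insertLetter n a T) T

/-- One step of reverse insertion: letter `g` comes back (moving leftward) into a column;
returns the restored column together with the letter passed further left. -/
def revStep (n g : ℕ) (C : List ℕ) : List ℕ × ℕ :=
  match C with
  | [p] => ([g], p)
  | [p, q] =>
      if p ≠ 0 ∧ p ≤ n ∧ q = bar n p ∧ p ≤ g ∧ g ≤ q then
        ([g, bar n (p - 1)], p - 1)
      else if p ≤ n ∧ g = bar n p ∧ p < q ∧ q < g ∧ p ≠ n then
        ([p + 1, bar n (p + 1)], q)
      else if q ≤ g then ([p, g], q)
      else ([g, q], p)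
  | _ => (C, g)

/-- Reverse insertion of a letter through a list of columns, from right to left;
returns the new columns and the letter ejected from the leftmost column. -/
def revPass (n g : ℕ) : List (List ℕ) → List (List ℕ) × ℕ
  | [] => ([], g)
  | C :: rest =>
      let p := revPass n g rest
      let q := revStep n p.2 C
      (q.1 :: p.1, q.2)

/-- Reverse-bump the rightmost cell of the first row (the last column, a single box). -/
def rbFirst (n : ℕ) (T : List (List ℕ)) : List (List ℕ) × ℕ :=
  match T.getLast? with
  | some [a] => revPass n a T.dropLast
  | _ => (T, 0)

/-- Number of columns of height (at least) two, i.e. the length of the second row. -/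
def numTwoCols (T : List (List ℕ)) : ℕ :=
  (T.filter (fun C => decide (2 ≤ C.length))).length

/-- Reverse-bump the rightmost cell of the second row. -/
def rbSecond (n : ℕ) (T : List (List ℕ)) : List (List ℕ) × ℕ :=
  match (T.drop (numTwoCols T - 1)).head? with
  | some [a, b] =>
      let p := revPass n b (T.take (numTwoCols T - 1))
      (p.1 ++ [a] :: T.drop (numTwoCols T), p.2)
  | _ => (T, 0)

/-- Iterate a reverse-bumping step, collecting the ejected letters in order of ejection. -/
def rbIter (step : List (List ℕ) → List (List ℕ) × ℕ) :
    ℕ → List (List ℕ) → List (List ℕ) × List ℕ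
  | 0, T => (T, [])
  | c + 1, T =>
      let p := step T
      let q := rbIter step c p.1
      (q.1, p.2 :: q.2)

/-- A one-row word regarded as a tableau (list of one-box columns). -/
def rowCols (w : List ℕ) : List (List ℕ) := w.map (fun a => [a])

/-- The row word of a one-row tableau. -/
def colsWord (T : List (List ℕ)) : List ℕ := T.foldr (fun C acc => C ++ acc) []

/-- The word `1^{x_1} ⋯ n^{x_n} n̄^{x̄_n} ⋯ 1̄^{x̄_1}`. -/
def coreWord (n : ℕ) (b : Tup n) : List ℕ :=
  ((List.finRange n).map (fun i => List.replicate (b.1 i) ((i : ℕ) + 1))).foldr (· ++ ·) []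
  ++ ((List.finRange n).reverse.map
      (fun i => List.replicate (b.2 i) (bar n ((i : ℕ) + 1)))).foldr (· ++ ·) []

/-- The word `𝕋(b) = 0^{x_0} 1^{x_1} ⋯ 1̄^{x̄_1} 0̄^{x_0}` of an element of the
`C_n^{(1)}` crystal `B_l`. -/
def rowWordC (n l : ℕ) (b : Tup n) : List ℕ :=
  List.replicate (x0 l b) 0 ++ coreWord n b ++ List.replicate (x0 l b) (bar n 0)

/-- The word `𝕋(b)` with `z` pairs `(0, 0̄)` removed. -/
def hatWordC (n l z : ℕ) (b : Tup n) : List ℕ :=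
  List.replicate (x0 l b - z) 0 ++ coreWord n b ++ List.replicate (x0 l b - z) (bar n 0)

/-- The word `𝒯(b) = 1^{x_1} ⋯ 1̄^{x̄_1}` of an element of the `A_{2n-1}^{(2)}` crystal. -/
def rowWordA (n : ℕ) (b : Tup n) : List ℕ := coreWord n b




/-! #### Insertion -/

lemma ins_pass (n α r : ℕ) (C : List ℕ) (T : List (List ℕ))
    (h : ∀ rest, insertLetter n α (C :: rest) = C :: insertLetter n α rest) :
    insertLetter n α (List.replicate r C ++ T) = List.replicate r C ++ insertLetter n α T := by
  induction r with
  | zero => simp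
  | succ r ih => simp [List.replicate_succ, h, ih]

lemma rep_snoc (r : ℕ) (C : List ℕ) (T : List (List ℕ)) :
    List.replicate r C ++ C :: T = List.replicate (r + 1) C ++ T := by
  rw [List.replicate_succ', List.append_assoc]; rfl

def S1 (n J : ℕ) : List (List ℕ) := List.replicate J [2 * n + 1]
def S3 (n F G J : ℕ) : List (List ℕ) :=
  List.replicate F [1, 2 * n + 1] ++ (List.replicate G [1] ++ S1 n J)
def S5 (n E e F G J : ℕ) : List (List ℕ) :=
  List.replicate E [1, 2] ++ (List.replicate e [1, 2 * n] ++ S3 n F G J)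
def S7 (n D z E e F G J : ℕ) : List (List ℕ) :=
  List.replicate D [0, 2 * n] ++ (List.replicate z [0] ++ S5 n E e F G J)
def S8 (n B D z E e F G J : ℕ) : List (List ℕ) :=
  List.replicate B [0, 2] ++ S7 n D z E e F G J
def S9 (n A B D z E e F G J : ℕ) : List (List ℕ) :=
  List.replicate A [0, 1] ++ S8 n B D z E e F G J

lemma ins0b_S1 (n J : ℕ) : insertLetter n (2 * n + 1) (S1 n J) = S1 n (J + 1) := by
  have := ins_pass n (2*n+1) J [2*n+1] [] (by intro rest; simp [insertLetter])
  simp only [List.append_nil] at this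
  rw [S1, this, S1, List.replicate_succ']; simp [insertLetter]

lemma ins0b_S3 (n F G J : ℕ) (hn : 2 ≤ n) :
    insertLetter n (2 * n + 1) (S3 n F G J) = S3 n (F + min 1 G) (G - 1) (J + (1 - G)) := by
  rw [S3, ins_pass]
  · rcases G with _ | G
    · simp [S3, ins0b_S1]
    · have : ¬ (n = 0) := by omega
      have h2 : min 1 (G+1) = 1 := by omega
      simp [S3, List.replicate_succ, insertLetter, this, h2]
      rw [rep_snoc]; simp [List.replicate_succ]
  · intro rest
    have : ¬ (n = 0) := by omega
    simp [insertLetter, bar, this]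

/-- availability of `1̄` -/
lemma ins1b_S7 (n D z e F G J : ℕ) (hn : 2 ≤ n) (he : e ≤ 1) (hz : 0 < z → e = 0 ∧ F = 0)
    (hav : 0 < z + e + F + G) :
    ∃ D' z' e' F' G' J', insertLetter n (2 * n) (S7 n D z 0 e F G J) = S7 n D' z' 0 e' F' G' J' ∧
      e' ≤ 1 ∧ (0 < z' → e' = 0 ∧ F' = 0) ∧ 2 * D' + z' + e' = 2 * D + z + e + 1 ∧
      D' + z' + J + F = D + z + J' + F' ∧ F' + G' + D + 1 = F + G + D' ∧
      (J' = J ∨ (G' = 0 ∧ J' = J + 1)) ∧ G' ≤ G ∧ (0 < z' → J' = J ∧ 0 < z) := by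
  have n0 : ¬ (n = 0) := by omega
  have st : ∀ rest, insertLetter n (2*n) ([0, 2*n] :: rest) = [0,2*n] :: insertLetter n (2*n) rest := by
    intro rest; simp [insertLetter, bar, n0] <;> (intros; omega)
  rw [S7, ins_pass _ _ _ _ _ st]
  rcases z with _ | z
  · rcases e with _ | e
    · rcases F with _ | F
      · obtain ⟨G, rfl⟩ : ∃ g, G = g + 1 := ⟨G - 1, by omega⟩
        refine ⟨D, 0, 1, 0, G, J, ?_, by omega⟩
        simp [S7, S5, S3, List.replicate_succ, insertLetter]
        intros; omega
      · refine ⟨D, 0, 1, F + min 1 G, G - 1, J + (1 - G), ?_, by omega⟩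
        have : insertLetter n (2*n) ([1, 2*n+1] :: S3 n F G J) = [1,2*n] :: insertLetter n (2*n+1) (S3 n F G J) := by
          simp [insertLetter, bar, n0] <;> (intros; omega)
        simp [S7, S5]
        rw [← ins0b_S3 _ _ _ _ hn, ← this]
        simp [S3, List.replicate_succ]
    · obtain rfl : e = 0 := by omega
      refine ⟨D + 1, 0, 0, F + min 1 G, G - 1, J + (1 - G), ?_, by omega⟩
      have : insertLetter n (2*n) ([1, 2*n] :: S3 n F G J) = [0,2*n] :: insertLetter n (2*n+1) (S3 n F G J) := by
        simp [insertLetter, bar, n0] <;> (intros; omega)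
      simp [S7, S5, this, ins0b_S3 _ _ _ _ hn]
      rw [rep_snoc]
  · obtain ⟨rfl, rfl⟩ := hz (by omega)
    refine ⟨D + 1, z, 0, 0, G, J, ?_, by omega⟩
    have : ∀ rest, insertLetter n (2*n) ([0] :: rest) = [0,2*n] :: rest := by
      intro rest; simp [insertLetter, n0]
    simp [S7, S5, List.replicate_succ, this]
    rw [rep_snoc]; simp [List.replicate_succ]

lemma ins2_S8 (n B D z E e F G J : ℕ) (hn : 2 ≤ n) (he : e ≤ 1)
    (hz : 0 < z → E = 0 ∧ e = 0 ∧ F = 0) (hE : 0 < E → D = 0 ∧ e = 0 ∧ z = 0)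
    (hav : 0 < z + e + F + G) :
    ∃ B' D' z' E' e' F' G' J', insertLetter n 2 (S8 n B D z E e F G J) = S8 n B' D' z' E' e' F' G' J' ∧
      e' ≤ 1 ∧ (0 < z' → E' = 0 ∧ e' = 0 ∧ F' = 0) ∧ (0 < E' → D' = 0 ∧ e' = 0 ∧ z' = 0) ∧
      B' + E' = B + E + 1 ∧
      B' + 2 * D' + z' + e' = B + 2 * D + z + e ∧
      B' + D' + z' + J + F = B + D + z + J' + F' ∧ E' + F' + G' + D = E + F + G + D' ∧
      (J' = J ∨ (G' = 0 ∧ J' = J + 1)) ∧ G' ≤ G ∧ (0 < z' → J' = J ∧ 0 < z) := by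
  have n0 : ¬ (n = 0) := by omega
  have st : ∀ rest, insertLetter n 2 ([0, 2] :: rest) = [0,2] :: insertLetter n 2 rest := by
    intro rest; simp [insertLetter, bar]
  rw [S8, ins_pass _ _ _ _ _ st]
  rcases D with _ | D
  · rcases z with _ | z
    · have st2 : ∀ rest, insertLetter n 2 ([1, 2] :: rest) = [1,2] :: insertLetter n 2 rest := by
        intro rest; simp [insertLetter, bar]; rw [if_neg (by omega), if_neg (by omega)]
      rcases e with _ | e
      · rcases F with _ | F
        · obtain ⟨G, rfl⟩ : ∃ g, G = g + 1 := ⟨G - 1, by omega⟩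
          refine ⟨B, 0, 0, E + 1, 0, 0, G, J, ?_, by omega⟩
          simp [S8, S7, S5, S3]
          rw [ins_pass _ _ _ _ _ st2]
          simp [List.replicate_succ, insertLetter]
          rw [rep_snoc]; simp [List.replicate_succ]
        · refine ⟨B, 0, 0, E + 1, 0, F + min 1 G, G - 1, J + (1 - G), ?_, by omega⟩
          have : insertLetter n 2 ([1, 2*n+1] :: S3 n F G J) = [1,2] :: insertLetter n (2*n+1) (S3 n F G J) := by
            simp [insertLetter, bar, n0] <;> (intros; omega)
          simp [S8, S7, S5]
          rw [ins_pass _ _ _ _ _ st2, ← ins0b_S3 _ _ _ _ hn, ← rep_snoc, ← this]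
          simp [S3, List.replicate_succ]
      · obtain rfl : e = 0 := by omega
        obtain rfl : E = 0 := by omega
        refine ⟨B + 1, 0, 0, 0, 0, F + min 1 G, G - 1, J + (1 - G), ?_, by omega⟩
        have : insertLetter n 2 ([1, 2*n] :: S3 n F G J) = [0,2] :: insertLetter n (2*n+1) (S3 n F G J) := by
          have : 2 ≤ 2 * n := by omega
          simp [insertLetter, bar, n0, this] <;> (intros; omega)
        simp [S8, S7, S5, this, ins0b_S3 _ _ _ _ hn]
        rw [rep_snoc]
    · obtain ⟨rfl, rfl, rfl⟩ := hz (by omega)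
      refine ⟨B + 1, 0, z, 0, 0, 0, G, J, ?_, by omega⟩
      have : ∀ rest, insertLetter n 2 ([0] :: rest) = [0,2] :: rest := by
        intro rest; simp [insertLetter]
      simp [S8, S7, S5, List.replicate_succ, this]
      rw [rep_snoc]; simp [List.replicate_succ]
  · obtain rfl : E = 0 := by omega
    obtain ⟨D', z', e', F', G', J', h, hh⟩ := ins1b_S7 n D z e F G J hn he (by omega) hav
    refine ⟨B + 1, D', z', 0, e', F', G', J', ?_, by omega⟩
    have : insertLetter n 2 ([0, 2*n] :: S7 n D z 0 e F G J) = [0,2] :: insertLetter n (2*n) (S7 n D z 0 e F G J) := by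
      have : 2 ≤ 2 * n := by omega
      simp [insertLetter, bar, n0, this]
    rw [S8, ← rep_snoc, ← h, ← this]
    simp [S7, List.replicate_succ]

lemma ins1_S9 (n A B D z E e F G J : ℕ) (hn : 2 ≤ n) (he : e ≤ 1)
    (hz : 0 < z → E = 0 ∧ e = 0 ∧ F = 0) (hE : 0 < E → D = 0 ∧ e = 0 ∧ z = 0)
    (hav : 0 < z + e + F + G) (hab : 0 < B + D + z + e) :
    ∃ B' D' z' E' e' F' G' J', insertLetter n 1 (S9 n A B D z E e F G J) = S9 n (A + 1) B' D' z' E' e' F' G' J' ∧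
      e' ≤ 1 ∧ (0 < z' → E' = 0 ∧ e' = 0 ∧ F' = 0) ∧ (0 < E' → D' = 0 ∧ e' = 0 ∧ z' = 0) ∧
      B' + E' = B + E ∧
      B' + 2 * D' + z' + e' + 1 = B + 2 * D + z + e ∧
      B' + D' + z' + J + F + 1 = B + D + z + J' + F' ∧ E' + F' + G' + D = E + F + G + D' ∧
      (J' = J ∨ (G' = 0 ∧ J' = J + 1)) ∧ G' ≤ G ∧ (0 < z' → J' = J ∧ 0 < z) := by
  have n0 : ¬ (n = 0) := by omega
  have st : ∀ rest, insertLetter n 1 ([0, 1] :: rest) = [0,1] :: insertLetter n 1 rest := by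
    intro rest; simp [insertLetter, bar]
  rw [S9, ins_pass _ _ _ _ _ st]
  rcases B with _ | B
  · rcases D with _ | D
    · rcases z with _ | z
      · obtain rfl : e = 1 := by omega
        obtain rfl : E = 0 := by omega
        refine ⟨0, 0, 0, 0, 0, F + min 1 G, G - 1, J + (1 - G), ?_, by omega⟩
        have : insertLetter n 1 ([1, 2*n] :: S3 n F G J) = [0,1] :: insertLetter n (2*n+1) (S3 n F G J) := by
          have : 1 ≤ 2 * n := by omega
          simp [insertLetter, bar, n0, this] <;> (intros; omega)
        simp [S9, S8, S7, S5, this, ins0b_S3 _ _ _ _ hn]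
        rw [rep_snoc]
      · obtain ⟨rfl, rfl, rfl⟩ := hz (by omega)
        refine ⟨0, 0, z, 0, 0, 0, G, J, ?_, by omega⟩
        have : ∀ rest, insertLetter n 1 ([0] :: rest) = [0,1] :: rest := by
          intro rest; simp [insertLetter]
        simp [S9, S8, S7, S5, List.replicate_succ, this]
        rw [rep_snoc]; simp [List.replicate_succ]
    · obtain rfl : E = 0 := by omega
      obtain ⟨D', z', e', F', G', J', h, hh⟩ := ins1b_S7 n D z e F G J hn he (by omega) hav
      refine ⟨0, D', z', 0, e', F', G', J', ?_, by omega⟩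
      have : insertLetter n 1 ([0, 2*n] :: S7 n D z 0 e F G J) = [0,1] :: insertLetter n (2*n) (S7 n D z 0 e F G J) := by
        have : 1 ≤ 2 * n := by omega
        simp [insertLetter, bar, n0, this]
      rw [S9, ← rep_snoc, show S8 n 0 D' z' 0 e' F' G' J' = S7 n D' z' 0 e' F' G' J' from rfl, ← h, ← this]
      simp [S8, S7, List.replicate_succ]
  · obtain ⟨B', D', z', E', e', F', G', J', h, hh⟩ := ins2_S8 n B D z E e F G J hn he hz hE hav
    refine ⟨B', D', z', E', e', F', G', J', ?_, by omega⟩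
    have : insertLetter n 1 ([0, 2] :: S8 n B D z E e F G J) = [0,1] :: insertLetter n 2 (S8 n B D z E e F G J) := by
      simp [insertLetter, bar]
    rw [S9, ← rep_snoc, ← h, ← this]
    simp [S8, List.replicate_succ]

lemma ins1_S1 (n J : ℕ) : insertLetter n 1 (S1 n J) = [1] :: S1 n J := by
  rcases J with _ | J
  · simp [S1, insertLetter]
  · have := ins0b_S1 n J
    simp [S1, List.replicate_succ, insertLetter] at this ⊢
    exact this

lemma ins1_S3 (n F G J : ℕ) (hn : 2 ≤ n) : insertLetter n 1 (S3 n F G J) = S3 n F (G + 1) J := by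
  have n0 : ¬ (n = 0) := by omega
  rw [S3, ins_pass, ins_pass, ins1_S1, rep_snoc, S3]
  · intro rest; simp [insertLetter]
  · intro rest; simp [insertLetter, bar, (by omega : ¬ n = 1), (by omega : ¬ n ≤ 1)] <;> (intros; omega)

lemma ins1_S5 (n E F G J : ℕ) (hn : 2 ≤ n) : insertLetter n 1 (S5 n E 0 F G J) = S5 n E 0 F (G + 1) J := by
  have n0 : ¬ (n = 0) := by omega
  rw [S5, ins_pass, List.replicate_zero, List.nil_append, ins1_S3 _ _ _ _ hn]; rfl
  intro rest; simp [insertLetter, bar]; rw [if_neg (by omega), if_neg (by omega)]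

lemma ins1_S9' (n A E F G J : ℕ) (hn : 2 ≤ n) :
    insertLetter n 1 (S9 n A 0 0 0 E 0 F G J) = S9 n A 0 0 0 E 0 F (G + 1) J := by
  rw [S9, ins_pass]
  · simp [S9, S8, S7, ins1_S5 _ _ _ _ _ hn]
  · intro rest; simp [insertLetter, bar]

lemma ins0_S9 (n A B D z E e F G J : ℕ) (hn : 2 ≤ n) (he : e ≤ 1)
    (hz : 0 < z → E = 0 ∧ e = 0 ∧ F = 0) (hE : 0 < E → D = 0 ∧ e = 0 ∧ z = 0) :
    ∃ B' D' z' E' e' F' G', insertLetter n 0 (S9 n A B D z E e F G J) = S9 n A B' D' z' E' e' F' G' J ∧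
      e' ≤ 1 ∧ (0 < z' → E' = 0 ∧ e' = 0 ∧ F' = 0) ∧ (0 < E' → D' = 0 ∧ e' = 0 ∧ z' = 0) ∧
      B' + E' = B + E ∧
      B' + 2 * D' + z' + e' = B + 2 * D + z + e + 1 ∧
      B' + D' + z' + F = B + D + z + F' + 1 ∧ E' + F' + G' + D = E + F + G + D' := by
  have n0 : ¬ (n = 0) := by omega
  have st : ∀ x rest, insertLetter n 0 ([0, x] :: rest) = [0,x] :: insertLetter n 0 rest := by
    intro x rest; simp [insertLetter, bar]
  have st' : ∀ rest, insertLetter n 0 ([0] :: rest) = [0] :: insertLetter n 0 rest := by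
    intro rest; simp [insertLetter]
  rw [S9, ins_pass _ _ _ _ _ (st _), S8, ins_pass _ _ _ _ _ (st _), S7, ins_pass _ _ _ _ _ (st _),
    ins_pass _ _ _ _ _ st']
  rcases E with _ | E
  · rcases e with _ | e
    · rcases F with _ | F
      · refine ⟨B, D, z + 1, 0, 0, 0, G, ?_, by omega⟩
        have : insertLetter n 0 (S5 n 0 0 0 G J) = [0] :: S5 n 0 0 0 G J := by
          rcases G with _ | G
          · rcases J with _ | J
            · simp [S5, S3, S1, insertLetter]
            · have := ins0b_S1 n J
              simp [S5, S3, S1, List.replicate_succ, insertLetter] at this ⊢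
              exact this
          · have := ins1_S3 n 0 G J hn
            simp [S3] at this
            simp [S5, S3, List.replicate_succ, insertLetter, this]
        rw [this, rep_snoc]; rfl
      · obtain rfl : z = 0 := by omega
        refine ⟨B, D, 0, 0, 1, F, G + 1, ?_, by omega⟩
        have : insertLetter n 0 ([1, 2*n+1] :: S3 n F G J) = [1,2*n] :: insertLetter n 1 (S3 n F G J) := by
          have : n + 1 ≤ 2 * n + 1 := by omega
          simp [insertLetter, bar, n0, this]
        simp [S9, S8, S7, S5]
        rw [← ins1_S3 _ _ _ _ hn, ← this]
        simp [S3, List.replicate_succ]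
    · obtain rfl : e = 0 := by omega
      obtain rfl : z = 0 := by omega
      refine ⟨B, D + 1, 0, 0, 0, F, G + 1, ?_, by omega⟩
      have : insertLetter n 0 ([1, 2*n] :: S3 n F G J) = [0,2*n] :: insertLetter n 1 (S3 n F G J) := by
        simp [insertLetter, bar]
      simp [S9, S8, S7, S5, this, ins1_S3 _ _ _ _ hn]
      rw [rep_snoc]
  · obtain ⟨rfl, rfl, rfl⟩ := hE (by omega)
    refine ⟨B + 1, 0, 0, E, 0, F, G + 1, ?_, by omega⟩
    have : insertLetter n 0 ([1, 2] :: S5 n E 0 F G J) = [0,2] :: insertLetter n 1 (S5 n E 0 F G J) := by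
      simp [insertLetter, bar, (by omega : ¬ n = 1), (by omega : ¬ n ≤ 1)] <;> (intros; omega)
    rw [ins1_S5 _ _ _ _ _ hn] at this
    rw [S9, S8, ← rep_snoc]
    simp [S7]
    rw [← this]; simp [S5, List.replicate_succ]


/-- Invariant describing the tableau before the insertion of the letters `0`. -/
def Inv (l p q d c A Y B D z E e F G J : ℕ) : Prop :=
  B + E = c ∧ e ≤ 1 ∧ (0 < z → E = 0 ∧ e = 0 ∧ F = 0 ∧ J = p) ∧ (0 < E → D = 0 ∧ e = 0 ∧ z = 0) ∧
  A + B + 2 * D + z + e = p + d ∧ A + B + D + z + q = J + F ∧ E + F + G + 2 * p + d = l + Y + D ∧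
  p ≤ J ∧ Y ≤ G ∧ (J = p ∨ G = Y) ∧ (0 < Y → A = p + d)

lemma insertWord_append (n : ℕ) (u v : List ℕ) (T) :
    insertWord n (u ++ v) T = insertWord n u (insertWord n v T) := by
  simp [insertWord]

lemma insertWord_succ (n j α : ℕ) (T) :
    insertWord n (List.replicate (j+1) α) T = insertLetter n α (insertWord n (List.replicate j α) T) := by
  simp [insertWord, List.replicate_succ]

lemma stage1 (n l q : ℕ) (hn : 2 ≤ n) :
    ∃ F G J, insertWord n (List.replicate q (2*n+1)) (S9 n 0 0 0 0 0 0 0 l 0) = S9 n 0 0 0 0 0 0 F G J ∧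
      F + G = l ∧ F + J = q ∧ (J = 0 ∨ G = 0) := by
  induction q with
  | zero => exact ⟨0, l, 0, by simp [insertWord], by omega⟩
  | succ q ih =>
    obtain ⟨F, G, J, h, hh⟩ := ih
    refine ⟨F + min 1 G, G - 1, J + (1 - G), ?_, by omega⟩
    rw [insertWord_succ, h]
    have := ins0b_S3 n F G J hn
    simpa [S9, S8, S7, S5] using this

lemma stage12 (n l p q : ℕ) (hn : 2 ≤ n) (hpq : p = 0 ∨ q = 0) (hp : 2 * p ≤ l) :
    ∃ z F G J, insertWord n (List.replicate q (2*n+1)) (S9 n 0 0 0 p 0 0 0 (l-2*p) p) = S9 n 0 0 0 z 0 0 F G J ∧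
      Inv l p q 0 0 0 0 0 0 z 0 0 F G J := by
  rcases Nat.eq_zero_or_pos q with rfl | hq
  · exact ⟨p, 0, l-2*p, p, by simp [insertWord], by unfold Inv; omega⟩
  · obtain rfl : p = 0 := by omega
    obtain ⟨F, G, J, h, hh⟩ := stage1 n l q hn
    exact ⟨0, F, G, J, by simpa using h, by unfold Inv; omega⟩

lemma stage2 (n l p q d : ℕ) (hn : 2 ≤ n) (hpq : p = 0 ∨ q = 0) (hp : 2 * p + d ≤ l) :
    ∃ D z e F G J, insertWord n (List.replicate d (2*n)) (insertWord n (List.replicate q (2*n+1))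
      (S9 n 0 0 0 p 0 0 0 (l-2*p) p)) = S9 n 0 0 D z 0 e F G J ∧
      Inv l p q d 0 0 0 0 D z 0 e F G J := by
  induction d with
  | zero =>
    obtain ⟨z, F, G, J, h, hh⟩ := stage12 n l p q hn hpq (by omega)
    exact ⟨0, z, 0, F, G, J, by simpa [insertWord] using h, hh⟩
  | succ d ih =>
    obtain ⟨D, z, e, F, G, J, h, hh⟩ := ih (by omega)
    unfold Inv at hh
    obtain ⟨D', z', e', F', G', J', h', hh'⟩ := ins1b_S7 n D z e F G J hn (by omega) (by omega) (by omega)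
    refine ⟨D', z', e', F', G', J', ?_, by unfold Inv; omega⟩
    rw [insertWord_succ, h]
    simpa [S9, S8] using h'

lemma stage3 (n l p q d c : ℕ) (hn : 2 ≤ n) (hpq : p = 0 ∨ q = 0) (hp : 2 * p + d + c ≤ l) :
    ∃ B D z E e F G J, insertWord n (List.replicate c 2) (insertWord n (List.replicate d (2*n))
      (insertWord n (List.replicate q (2*n+1))
      (S9 n 0 0 0 p 0 0 0 (l-2*p) p))) = S9 n 0 B D z E e F G J ∧
      Inv l p q d c 0 0 B D z E e F G J := by
  induction c with
  | zero =>
    obtain ⟨D, z, e, F, G, J, h, hh⟩ := stage2 n l p q d hn hpq (by omega)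
    exact ⟨0, D, z, 0, e, F, G, J, by simpa [insertWord] using h, hh⟩
  | succ c ih =>
    obtain ⟨B, D, z, E, e, F, G, J, h, hh⟩ := ih (by omega)
    unfold Inv at hh
    obtain ⟨B', D', z', E', e', F', G', J', h', hh'⟩ := ins2_S8 n B D z E e F G J hn (by omega) (by omega) (by omega) (by omega)
    refine ⟨B', D', z', E', e', F', G', J', ?_, by unfold Inv; omega⟩
    rw [insertWord_succ, h]
    simpa [S9] using h'

lemma stage4 (n l p q d c a : ℕ) (hn : 2 ≤ n) (hpq : p = 0 ∨ q = 0) (hp : 2 * p + d + c ≤ l) :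
    ∃ A Y B D z E e F G J, insertWord n (List.replicate a 1) (insertWord n (List.replicate c 2)
      (insertWord n (List.replicate d (2*n)) (insertWord n (List.replicate q (2*n+1))
      (S9 n 0 0 0 p 0 0 0 (l-2*p) p)))) = S9 n A B D z E e F G J ∧
      A + Y = a ∧
      Inv l p q d c A Y B D z E e F G J := by
  induction a with
  | zero =>
    obtain ⟨B, D, z, E, e, F, G, J, h, hh⟩ := stage3 n l p q d c hn hpq (by omega)
    exact ⟨0, 0, B, D, z, E, e, F, G, J, by simpa [insertWord] using h, by omega, hh⟩
  | succ a ih =>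
    obtain ⟨A, Y, B, D, z, E, e, F, G, J, h, hA, hh⟩ := ih
    unfold Inv at hh
    rcases Nat.eq_zero_or_pos (B + D + z + e) with h0 | h0
    · obtain rfl : B = 0 := by omega
      obtain rfl : D = 0 := by omega
      obtain rfl : z = 0 := by omega
      obtain rfl : e = 0 := by omega
      refine ⟨A, Y + 1, 0, 0, 0, E, 0, F, G + 1, J, ?_, by omega, by unfold Inv; omega⟩
      rw [insertWord_succ, h, ins1_S9' _ _ _ _ _ _ hn]
    · obtain ⟨B', D', z', E', e', F', G', J', h', hh'⟩ := ins1_S9 n A B D z E e F G J hn (by omega) (by omega) (by omega) (by omega) h0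
      refine ⟨A + 1, Y, B', D', z', E', e', F', G', J', ?_, by omega, by unfold Inv; omega⟩
      rw [insertWord_succ, h, h']

lemma stage5 (n l p q d c a j : ℕ) (hn : 2 ≤ n) (hpq : p = 0 ∨ q = 0) (hp : 2 * p + d + c ≤ l)
    (hj : j ≤ q) :
    ∃ A J B D z E e F G, insertWord n (List.replicate j 0) (insertWord n (List.replicate a 1) (insertWord n (List.replicate c 2)
      (insertWord n (List.replicate d (2*n)) (insertWord n (List.replicate q (2*n+1))
      (S9 n 0 0 0 p 0 0 0 (l-2*p) p))))) = S9 n A B D z E e F G J ∧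
      A = min a (p + d) ∧ J = max p (2 * p + q + d + c + A - l) ∧
      B + E = c ∧ e ≤ 1 ∧ (0 < z → E = 0 ∧ e = 0 ∧ F = 0) ∧ (0 < E → D = 0 ∧ e = 0 ∧ z = 0) ∧
      A + B + 2 * D + z + e = p + d + j ∧ A + B + D + z + q = J + F + j ∧
      E + F + G + 2 * p + d + A = l + a + D := by
  induction j with
  | zero =>
    obtain ⟨A, Y, B, D, z, E, e, F, G, J, h, hA, hh⟩ := stage4 n l p q d c a hn hpq (by omega)
    unfold Inv at hh
    exact ⟨A, J, B, D, z, E, e, F, G, by simpa [insertWord] using h, by omega⟩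
  | succ j ih =>
    obtain ⟨A, J, B, D, z, E, e, F, G, h, hh⟩ := ih (by omega)
    obtain ⟨B', D', z', E', e', F', G', h', hh'⟩ := ins0_S9 n A B D z E e F G J hn (by omega) (by omega) (by omega)
    refine ⟨A, J, B', D', z', E', e', F', G', ?_, by omega⟩
    rw [insertWord_succ, h, h']

lemma rowCols_start (n l p : ℕ) : rowCols (List.replicate p 0 ++ List.replicate (l-2*p) 1 ++ List.replicate p (2*n+1))
    = S9 n 0 0 0 p 0 0 0 (l-2*p) p := by
  simp [rowCols, S9, S8, S7, S5, S3, S1]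

lemma tabFinal (n l p q d c a : ℕ) (hn : 2 ≤ n) (hpq : p = 0 ∨ q = 0) (hp : 2 * p + d + c ≤ l) :
    ∃ A J B D z E e F G, insertWord n (List.replicate q 0 ++ (List.replicate a 1 ++ List.replicate c 2
      ++ List.replicate d (2*n)) ++ List.replicate q (2*n+1))
      (rowCols (List.replicate p 0 ++ List.replicate (l-2*p) 1 ++ List.replicate p (2*n+1))) =
        S9 n A B D z E e F G J ∧
      A = min a (p + d) ∧ J = max p (2 * p + q + d + c + A - l) ∧
      B + E = c ∧ e ≤ 1 ∧ (0 < z → E = 0 ∧ e = 0 ∧ F = 0) ∧ (0 < E → D = 0 ∧ e = 0 ∧ z = 0) ∧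
      A + B + 2 * D + z + e = p + d + q ∧ A + B + D + z = J + F ∧
      E + F + G + 2 * p + d + A = l + a + D := by
  obtain ⟨A, J, B, D, z, E, e, F, G, h, hh⟩ := stage5 n l p q d c a q hn hpq hp le_rfl
  refine ⟨A, J, B, D, z, E, e, F, G, ?_, by omega⟩
  rw [rowCols_start, insertWord_append, insertWord_append, insertWord_append, insertWord_append]
  exact h

lemma tabUniq (s c w A J B D z E e F G B' D' z' E' e' F' G' : ℕ)
    (h1 : B + E = c) (h2 : e ≤ 1) (h3 : 0 < z → E = 0 ∧ e = 0 ∧ F = 0)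
    (h4 : 0 < E → D = 0 ∧ e = 0 ∧ z = 0)
    (h5 : A + B + 2 * D + z + e = s) (h6 : A + B + D + z = J + F) (h7 : E + F + G + A = w + D)
    (g1 : B' + E' = c) (g2 : e' ≤ 1) (g3 : 0 < z' → E' = 0 ∧ e' = 0 ∧ F' = 0)
    (g4 : 0 < E' → D' = 0 ∧ e' = 0 ∧ z' = 0)
    (g5 : A + B' + 2 * D' + z' + e' = s) (g6 : A + B' + D' + z' = J + F')
    (g7 : E' + F' + G' + A = w + D') :
    B = B' ∧ D = D' ∧ z = z' ∧ E = E' ∧ e = e' ∧ F = F' ∧ G = G' := by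
  have k1 : z = 0 ∨ (E = 0 ∧ e = 0 ∧ F = 0) := by omega
  have k2 : z' = 0 ∨ (E' = 0 ∧ e' = 0 ∧ F' = 0) := by omega
  have k3 : E = 0 ∨ (D = 0 ∧ e = 0 ∧ z = 0) := by omega
  have k4 : E' = 0 ∨ (D' = 0 ∧ e' = 0 ∧ z' = 0) := by omega
  clear h3 h4 g3 g4
  have key : E = E' ∧ z = z' ∧ D = D' := by
    have q1 : (z = 0 ∧ E = 0) ∨ (0 < z ∧ E = 0 ∧ e = 0 ∧ F = 0) ∨ (0 < E ∧ D = 0 ∧ e = 0 ∧ z = 0) := by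
      clear g1 g2 g5 g6 g7 k2 k4; omega
    have q2 : (z' = 0 ∧ E' = 0) ∨ (0 < z' ∧ E' = 0 ∧ e' = 0 ∧ F' = 0) ∨
        (0 < E' ∧ D' = 0 ∧ e' = 0 ∧ z' = 0) := by
      clear h1 h2 h5 h6 h7 k1 k3; omega
    clear k1 k2 k3 k4 h7 g7
    rcases q1 with q1 | q1 | q1 <;> rcases q2 with q2 | q2 | q2 <;>
      refine ⟨?_, ?_, ?_⟩ <;> omega
  obtain ⟨rfl, rfl, rfl⟩ := key
  clear k1 k2 k3 k4
  refine ⟨?_, rfl, rfl, rfl, ?_, ?_, ?_⟩ <;> omega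

lemma tabA1 (p q d a : ℕ) (hpq : p = 0 ∨ q = 0) :
    min a (p + d) = min (min a (d + 2 * p)) (p + q + d) := by
  omega

lemma tabA2 (p q d a A M : ℕ) (hpq : p = 0 ∨ q = 0)
    (hM : M = min a (d + 2 * p)) (hA : A = min a (p + d)) :
    (p + A - q - a) + M = p + A := by
  omega

lemma tabArith (l k p q d c a p' q' d' a' : ℕ) (hpq : p = 0 ∨ q = 0)
    (hpq' : p' = 0 ∨ q' = 0)
    (hp : 2 * p + d + c ≤ l) (hp' : 2 * p' + d' + c ≤ k)
    (ha : a + c + d + 2 * q = k) (ha' : a' + c + d' + 2 * q' = l)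
    (hs : p + q + d = p' + q' + d') (hm : min a (d + 2 * p) = min a' (d' + 2 * p')) :
    min a (p + d) = min a' (p' + d') ∧
    max p (2 * p + q + d + c + min a (p + d) - l) =
      max p' (2 * p' + q' + d' + c + min a' (p' + d') - k) ∧
    max p (2 * p + q + d + c + min a (p + d) - l) + min a (d + 2 * p) =
      p + p' + min a (p + d) := by
  obtain ⟨M, hM⟩ : ∃ M, M = min a (d + 2 * p) := ⟨_, rfl⟩
  obtain ⟨A, hA⟩ : ∃ A, A = min a (p + d) := ⟨_, rfl⟩
  obtain ⟨A', hA'⟩ : ∃ A, A = min a' (p' + d') := ⟨_, rfl⟩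
  rw [← hM] at hm ⊢
  rw [← hA, ← hA']
  have h1 : A = A' := by
    rw [hA, hA', tabA1 p q d a hpq, tabA1 p' q' d' a' hpq', ← hM, ← hm, hs]
  subst h1
  have h2 := tabA2 p q d a A M hpq hM hA
  have h3 := tabA2 p' q' d' a' A M hpq' hm hA'
  clear hM hm hA hA' hpq hpq'
  have h2 : max p (2 * p + q + d + c + A - l) + M = p + p' + A := by
    omega
  have h3 : max p' (2 * p' + q' + d' + c + A - k) + M = p + p' + A := by
    omega
  refine ⟨rfl, ?_, h2⟩
  omega

lemma tabSame (n l k p q d c a p' q' d' a' : ℕ) (hn : 2 ≤ n) (hpq : p = 0 ∨ q = 0)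
    (hpq' : p' = 0 ∨ q' = 0)
    (hp : 2 * p + d + c ≤ l) (hp' : 2 * p' + d' + c ≤ k)
    (ha : a + c + d + 2 * q = k) (ha' : a' + c + d' + 2 * q' = l)
    (hs : p + q + d = p' + q' + d') (hm : min a (d + 2 * p) = min a' (d' + 2 * p')) :
    let T := insertWord n (List.replicate q 0 ++ (List.replicate a 1 ++ List.replicate c 2
      ++ List.replicate d (2*n)) ++ List.replicate q (2*n+1))
      (rowCols (List.replicate p 0 ++ List.replicate (l-2*p) 1 ++ List.replicate p (2*n+1)))
    T = insertWord n (List.replicate q' 0 ++ (List.replicate a' 1 ++ List.replicate c 2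
      ++ List.replicate d' (2*n)) ++ List.replicate q' (2*n+1))
      (rowCols (List.replicate p' 0 ++ List.replicate (k-2*p') 1 ++ List.replicate p' (2*n+1))) ∧
    T.length + (min a (d + 2 * p) + p + q + d + c) = l + k + p + p' := by
  obtain ⟨A, J, B, D, z, E, e, F, G, h, hh⟩ := tabFinal n l p q d c a hn hpq hp
  obtain ⟨A', J', B', D', z', E', e', F', G', h', hh'⟩ := tabFinal n k p' q' d' c a' hn hpq' hp'
  dsimp only
  rw [h, h']
  obtain ⟨m1, m2, m3⟩ := tabArith l k p q d c a p' q' d' a' hpq hpq' hp hp' ha ha' hs hm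
  have hA : A = A' := by rw [hh.1, hh'.1, m1]
  have hJ : J = J' := by rw [hh.2.1, hh'.2.1, hh.1, hh'.1, m2]
  clear h h'
  obtain ⟨a1, a2, a3, a4, a5, a6, a7, a8, a9⟩ := hh
  obtain ⟨c1, c2, c3, c4, c5, c6, c7, c8, c9⟩ := hh'
  rw [← hA] at c7 c8 c9
  rw [← hJ] at c8
  rw [← hA, ← hJ]
  obtain ⟨r1, r2, r3, r4, r5, r6, r7⟩ := tabUniq (p+q+d) c (l+a-2*p-d) A J B D z E e F G B' D' z' E' e' F' G' a3 a4 a5 a6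
    (by omega) (by omega) (by omega) c3 c4 c5 c6 (by omega) (by omega) (by omega)
  clear m1 m2 c1 c2 c4 c5 c6 c7 c8 c9 hJ hA hm 
  rw [← r1, ← r2, ← r3, ← r4, ← r5, ← r6, ← r7]
  clear r1 r2 r3 r4 r5 r6 r7 c3
  refine ⟨rfl, ?_⟩
  simp [S9, S8, S7, S5, S3, S1]
  rw [← a1, ← a2] at m3
  clear a4 a5 a6 a1 a2
  omega


lemma xc_setx {n : ℕ} (f g : Fin n → ℕ) (j v m : ℕ) (hm : 1 ≤ m) (hmn : m ≤ n) :
    xc (setx f j v, g) m = if m = j then v else xc (f, g) m := by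
  have h : m - 1 < n := by omega
  have h2 : m - 1 + 1 = m := by omega
  simp [xc, h, setx, h2]

lemma xbc_setx {n : ℕ} (f g : Fin n → ℕ) (j v m : ℕ) (hm : 1 ≤ m) (hmn : m ≤ n) :
    xbc (f, setx g j v) m = if m = j then v else xbc (f, g) m := by
  have h : m - 1 < n := by omega
  have h2 : m - 1 + 1 = m := by omega
  simp [xbc, h, setx, h2]

lemma xc_snd {n : ℕ} (f g g' : Fin n → ℕ) (m : ℕ) : xc (f, g) m = xc (f, g') m := rfl
lemma xbc_fst {n : ℕ} (f f' g : Fin n → ℕ) (m : ℕ) : xbc (f, g) m = xbc (f', g) m := rfl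

lemma sum_setx {n : ℕ} (f : Fin n → ℕ) (j v : ℕ) (hj : j - 1 < n) (h1 : 1 ≤ j) :
    ∑ i, setx f j v i + f ⟨j - 1, hj⟩ = ∑ i, f i + v := by
  have : setx f j v = Function.update f ⟨j-1, hj⟩ v := by
    funext t
    by_cases h : (t : ℕ) + 1 = j
    · have : t = ⟨j-1, hj⟩ := by ext; simp; omega
      subst this
      simp [setx, h]
    · have : t ≠ ⟨j-1, hj⟩ := by intro h'; subst h'; simp at h; omega
      simp [setx, h, this]
  rw [this, Finset.sum_update_of_mem (Finset.mem_univ _)]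
  have := Finset.add_sum_erase Finset.univ f (Finset.mem_univ (⟨j-1, hj⟩ : Fin n))
  rw [Finset.sdiff_singleton_eq_erase]
  omega

lemma tsum_eq {n : ℕ} (f g : Fin n → ℕ) : tsum (f, g) = ∑ i, f i + ∑ i, g i := by
  simp [tsum, Finset.sum_add_distrib]

lemma tsum_setx1 {n : ℕ} (f g : Fin n → ℕ) (j v : ℕ) (h1 : 1 ≤ j) (hj : j ≤ n) :
    tsum (setx f j v, g) + xc (f, g) j = tsum (f, g) + v := by
  have h : j - 1 < n := by omega
  have := sum_setx f j v h h1
  simp only [tsum_eq, xc, h, dite_true]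
  omega

lemma tsum_setx2 {n : ℕ} (f g : Fin n → ℕ) (j v : ℕ) (h1 : 1 ≤ j) (hj : j ≤ n) :
    tsum (f, setx g j v) + xbc (f, g) j = tsum (f, g) + v := by
  have h : j - 1 < n := by omega
  have := sum_setx g j v h h1
  simp only [tsum_eq, xbc, h, dite_true]
  omega

lemma xc_le_tsum {n : ℕ} (b : Tup n) (j : ℕ) (h1 : 1 ≤ j) (hj : j ≤ n) :
    xc b j + xbc b j ≤ tsum b := by
  have h : j - 1 < n := by omega
  simp only [xc, xbc, h, dite_true, tsum]
  exact Finset.single_le_sum (f := fun i => b.1 i + b.2 i) (fun _ _ => Nat.zero_le _) (Finset.mem_univ (⟨j-1,h⟩ : Fin n))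

lemma tup_ext {n : ℕ} (b c : Tup n) (h : ∀ m, 1 ≤ m → m ≤ n → xc b m = xc c m ∧ xbc b m = xbc c m) :
    b = c := by
  refine Prod.ext (funext fun t => ?_) (funext fun t => ?_)
  · have := (h (t+1) (by omega) (by omega)).1
    simpa [xc] using this
  · have := (h (t+1) (by omega) (by omega)).2
    simpa [xbc] using this

/-- closed form of `ε_i`. -/
def psiE (n l i : ℕ) (b : Tup n) : ℕ :=
  if i = 0 then x0 l b + (xc b 1 - xbc b 1)
  else if i = n then xbc b n
  else xbc b i + (xc b (i+1) - xbc b (i+1))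

/-- closed form of `φ_i`. -/
def psiF (n l i : ℕ) (b : Tup n) : ℕ :=
  if i = 0 then x0 l b + (xbc b 1 - xc b 1)
  else if i = n then xc b n
  else xc b i + (xbc b (i+1) - xc b (i+1))

/-- The entries of `b'` after the single crystal step `f_i b = b'`. -/
def StepF (n i : ℕ) (b b' : Tup n) : Prop :=
  ((i = 0 ∧ ((xbc b 1 ≤ xc b 1 ∧ xc b' 1 = xc b 1 + 2 ∧ xbc b' 1 = xbc b 1 ∧ tsum b' = tsum b + 2) ∨
    (xc b 1 + 1 = xbc b 1 ∧ xc b' 1 = xc b 1 + 1 ∧ xbc b' 1 + 1 = xbc b 1 ∧ tsum b' = tsum b) ∨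
    (xc b 1 + 2 ≤ xbc b 1 ∧ xc b' 1 = xc b 1 ∧ xbc b' 1 + 2 = xbc b 1 ∧ tsum b' + 2 = tsum b)) ∧
    ∀ m, 2 ≤ m → m ≤ n → xc b m = xc b' m ∧ xbc b m = xbc b' m) ∨
  (i ≠ 0 ∧ i = n ∧ xc b' n + 1 = xc b n ∧ xbc b' n = xbc b n + 1 ∧ tsum b' = tsum b ∧
    ∀ m, 1 ≤ m → m ≤ n → m ≠ n → xc b m = xc b' m ∧ xbc b m = xbc b' m) ∨
  (i ≠ 0 ∧ i < n ∧ tsum b' = tsum b ∧ (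
    (xbc b (i+1) ≤ xc b (i+1) ∧ xc b' i + 1 = xc b i ∧ xc b' (i+1) = xc b (i+1) + 1 ∧
      xbc b' i = xbc b i ∧ xbc b' (i+1) = xbc b (i+1)) ∨
    (xc b (i+1) < xbc b (i+1) ∧ xbc b' i = xbc b i + 1 ∧ xbc b' (i+1) + 1 = xbc b (i+1) ∧
      xc b' i = xc b i ∧ xc b' (i+1) = xc b (i+1))) ∧
    ∀ m, 1 ≤ m → m ≤ n → m ≠ i → m ≠ i + 1 → xc b m = xc b' m ∧ xbc b m = xbc b' m))

lemma fC_step (n l i : ℕ) (hn : 2 ≤ n) (b b' : Tup n) (h : fC n l i b = some b') :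
    StepF n i b b' ∧ (tsum b ≤ l → tsum b' ≤ l) := by
  obtain ⟨f, g⟩ := b
  unfold fC at h
  unfold StepF
  split_ifs at h with h1 h2 h3 h4 h5 h6 h7 h8 h9 h10 <;> simp only [Option.some.injEq] at h <;> subst h
  · subst h1
    have e1 := tsum_setx1 f g 1 (xc (f,g) 1 + 2) (by omega) (by omega)
    refine ⟨Or.inl ⟨rfl, Or.inl ⟨h3, ?_, rfl, ?_⟩, ?_⟩, ?_⟩
    · simp (disch := omega) only [xc_setx, if_true]
    · omega
    · intro m hm hmn
      simp (disch := omega) only [xc_setx, if_neg (by omega : ¬ m = 1), true_and]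
      rfl
    · omega
  · subst h1
    have e1 := tsum_setx1 f (setx g 1 (xbc (f,g) 1 - 1)) 1 (xc (f,g) 1 + 1) (by omega) (by omega)
    have e2 := tsum_setx2 f g 1 (xbc (f,g) 1 - 1) (by omega) (by omega)
    rw [xc_snd f (setx g _ _) g] at e1
    refine ⟨Or.inl ⟨rfl, Or.inr (Or.inl ⟨h5, ?_, ?_, ?_⟩), ?_⟩, ?_⟩
    · simp (disch := omega) only [xc_setx, if_true]
    · simp (disch := omega) only [xbc_setx, if_true]; omega
    · omega
    · intro m hm hmn
      simp (disch := omega) only [xc_setx, xbc_setx, if_neg (by omega : ¬ m = 1)]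
      first | exact ⟨rfl, rfl⟩ | exact ⟨rfl, trivial⟩ | exact ⟨trivial, rfl⟩
    · omega
  · subst h1
    have e2 := tsum_setx2 f g 1 (xbc (f,g) 1 - 2) (by omega) (by omega)
    refine ⟨Or.inl ⟨rfl, Or.inr (Or.inr ⟨by omega, rfl, ?_, ?_⟩), ?_⟩, ?_⟩
    · simp (disch := omega) only [xbc_setx, if_true]; omega
    · omega
    · intro m hm hmn
      simp (disch := omega) only [xbc_setx, if_neg (by omega : ¬ m = 1)]
      first | exact ⟨rfl, rfl⟩ | exact ⟨rfl, trivial⟩ | exact ⟨trivial, rfl⟩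
    · omega
  · subst h6
    have e1 := tsum_setx1 f (setx g i (xbc (f,g) i + 1)) i (xc (f,g) i - 1) (by omega) (by omega)
    have e2 := tsum_setx2 f g i (xbc (f,g) i + 1) (by omega) (by omega)
    rw [xc_snd f (setx g _ _) g] at e1
    refine ⟨Or.inr (Or.inl ⟨h1, rfl, ?_, ?_, ?_, ?_⟩), ?_⟩
    · simp (disch := omega) only [xc_setx, if_true]; omega
    · simp (disch := omega) only [xbc_setx, if_true]
    · omega
    · intro m hm hmn hne
      simp (disch := omega) only [xc_setx, xbc_setx, if_neg hne]
      first | exact ⟨rfl, rfl⟩ | exact ⟨rfl, trivial⟩ | exact ⟨trivial, rfl⟩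
    · omega
  · have e1 := tsum_setx1 (setx f i (xc (f,g) i - 1)) g (i+1) (xc (f,g) (i+1) + 1) (by omega) (by omega)
    have e2 := tsum_setx1 f g i (xc (f,g) i - 1) (by omega) (by omega)
    rw [xc_setx _ _ _ _ _ (by omega) (by omega), if_neg (by omega)] at e1
    refine ⟨Or.inr (Or.inr ⟨h1, h8, ?_, Or.inl ⟨h9, ?_, ?_, rfl, rfl⟩, ?_⟩), ?_⟩
    · omega
    · simp (disch := omega) only [xc_setx, if_true, if_neg (by omega : ¬ i = i + 1)]; omega
    · simp (disch := omega) only [xc_setx, if_true]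
    · intro m hm hmn hne hne'
      simp (disch := omega) only [xc_setx, if_neg hne, if_neg hne', true_and]
      rfl
    · omega
  · have e1 := tsum_setx2 f (setx g (i+1) (xbc (f,g) (i+1) - 1)) i (xbc (f,g) i + 1) (by omega) (by omega)
    have e2 := tsum_setx2 f g (i+1) (xbc (f,g) (i+1) - 1) (by omega) (by omega)
    rw [xbc_setx _ _ _ _ _ (by omega) (by omega), if_neg (by omega)] at e1
    refine ⟨Or.inr (Or.inr ⟨h1, h8, ?_, Or.inr ⟨by omega, ?_, ?_, rfl, rfl⟩, ?_⟩), ?_⟩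
    · omega
    · simp (disch := omega) only [xbc_setx, if_true]
    · simp (disch := omega) only [xbc_setx, if_true, if_neg (by omega : ¬ i + 1 = i)]; omega
    · intro m hm hmn hne hne'
      simp (disch := omega) only [xbc_setx, if_neg hne, if_neg hne']
      first | exact ⟨rfl, rfl⟩ | exact ⟨rfl, trivial⟩ | exact ⟨trivial, rfl⟩
    · omega

lemma eC_step (n l i : ℕ) (hn : 2 ≤ n) (b b' : Tup n) (h : eC n l i b = some b') :
    StepF n i b' b ∧ (tsum b ≤ l → tsum b' ≤ l) := by
  obtain ⟨f, g⟩ := b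
  unfold eC at h
  unfold StepF
  split_ifs at h with h1 h2 h3 h4 h5 h6 h7 h8 h9 <;> simp only [Option.some.injEq] at h <;> subst h
  · subst h1
    have e1 := tsum_setx1 f g 1 (xc (f,g) 1 - 2) (by omega) (by omega)
    have e3 : xc (setx f 1 (xc (f,g) 1 - 2), g) 1 = xc (f,g) 1 - 2 := by
      simp (disch := omega) only [xc_setx, if_true]
    have e4 : xbc (setx f 1 (xc (f,g) 1 - 2), g) 1 = xbc (f,g) 1 := rfl
    refine ⟨Or.inl ⟨rfl, Or.inl ⟨by omega, by omega, by omega, by omega⟩, ?_⟩, by omega⟩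
    intro m hm hmn
    simp (disch := omega) only [xc_setx, if_neg (by omega : ¬ m = 1), true_and]
    rfl
  · subst h1
    have e1 := tsum_setx1 f (setx g 1 (xbc (f,g) 1 + 1)) 1 (xc (f,g) 1 - 1) (by omega) (by omega)
    have e2 := tsum_setx2 f g 1 (xbc (f,g) 1 + 1) (by omega) (by omega)
    rw [xc_snd f (setx g _ _) g] at e1
    have e3 : xc (setx f 1 (xc (f,g) 1 - 1), setx g 1 (xbc (f,g) 1 + 1)) 1 = xc (f,g) 1 - 1 := by
      simp (disch := omega) only [xc_setx, if_true]
    have e4 : xbc (setx f 1 (xc (f,g) 1 - 1), setx g 1 (xbc (f,g) 1 + 1)) 1 = xbc (f,g) 1 + 1 := by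
      simp (disch := omega) only [xbc_setx, if_true]
    refine ⟨Or.inl ⟨rfl, Or.inr (Or.inl ⟨by omega, by omega, by omega, by omega⟩), ?_⟩, by omega⟩
    intro m hm hmn
    simp (disch := omega) only [xc_setx, xbc_setx, if_neg (by omega : ¬ m = 1)]
    first | exact ⟨rfl, rfl⟩ | exact ⟨rfl, trivial⟩ | exact ⟨trivial, rfl⟩
  · subst h1
    have e2 := tsum_setx2 f g 1 (xbc (f,g) 1 + 2) (by omega) (by omega)
    have e3 : xc (f, setx g 1 (xbc (f,g) 1 + 2)) 1 = xc (f,g) 1 := rfl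
    have e4 : xbc (f, setx g 1 (xbc (f,g) 1 + 2)) 1 = xbc (f,g) 1 + 2 := by
      simp (disch := omega) only [xbc_setx, if_true]
    refine ⟨Or.inl ⟨rfl, Or.inr (Or.inr ⟨by omega, by omega, by omega, by omega⟩), ?_⟩, by omega⟩
    intro m hm hmn
    simp (disch := omega) only [xbc_setx, if_neg (by omega : ¬ m = 1)]
    first | exact ⟨rfl, rfl⟩ | exact ⟨rfl, trivial⟩ | exact ⟨trivial, rfl⟩
  · subst h6
    have e1 := tsum_setx1 f (setx g i (xbc (f,g) i - 1)) i (xc (f,g) i + 1) (by omega) (by omega)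
    have e2 := tsum_setx2 f g i (xbc (f,g) i - 1) (by omega) (by omega)
    rw [xc_snd f (setx g _ _) g] at e1
    refine ⟨Or.inr (Or.inl ⟨h1, rfl, ?_, ?_, ?_, ?_⟩), ?_⟩
    · simp (disch := omega) only [xc_setx, if_true]
    · simp (disch := omega) only [xbc_setx, if_true]; omega
    · omega
    · intro m hm hmn hne
      simp (disch := omega) only [xc_setx, xbc_setx, if_neg hne]
      first | exact ⟨rfl, rfl⟩ | exact ⟨rfl, trivial⟩ | exact ⟨trivial, rfl⟩
    · omega
  · have e1 := tsum_setx1 (setx f i (xc (f,g) i + 1)) g (i+1) (xc (f,g) (i+1) - 1) (by omega) (by omega)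
    have e2 := tsum_setx1 f g i (xc (f,g) i + 1) (by omega) (by omega)
    rw [xc_setx _ _ _ _ _ (by omega) (by omega), if_neg (by omega)] at e1
    have e3 : xc (setx (setx f i (xc (f,g) i + 1)) (i+1) (xc (f,g) (i+1) - 1), g) (i+1) = xc (f,g) (i+1) - 1 := by
      simp (disch := omega) only [xc_setx, if_true]
    have e4 : xbc (setx (setx f i (xc (f,g) i + 1)) (i+1) (xc (f,g) (i+1) - 1), g) (i+1) = xbc (f,g) (i+1) := rfl
    refine ⟨Or.inr (Or.inr ⟨h1, h8, by omega, Or.inl ⟨by omega, ?_, by omega, rfl, rfl⟩, ?_⟩), by omega⟩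
    · simp (disch := omega) only [xc_setx, if_true, if_neg (by omega : ¬ i = i + 1)]
    · intro m hm hmn hne hne'
      simp (disch := omega) only [xc_setx, if_neg hne, if_neg hne', true_and]
      rfl
  · have e1 := tsum_setx2 f (setx g (i+1) (xbc (f,g) (i+1) + 1)) i (xbc (f,g) i - 1) (by omega) (by omega)
    have e2 := tsum_setx2 f g (i+1) (xbc (f,g) (i+1) + 1) (by omega) (by omega)
    rw [xbc_setx _ _ _ _ _ (by omega) (by omega), if_neg (by omega)] at e1
    have e3 : xbc (f, setx (setx g (i+1) (xbc (f,g) (i+1) + 1)) i (xbc (f,g) i - 1)) (i+1) = xbc (f,g) (i+1) + 1 := by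
      simp (disch := omega) only [xbc_setx, if_true, if_neg (by omega : ¬ i + 1 = i)]
    have e4 : xc (f, setx (setx g (i+1) (xbc (f,g) (i+1) + 1)) i (xbc (f,g) i - 1)) (i+1) = xc (f,g) (i+1) := rfl
    refine ⟨Or.inr (Or.inr ⟨h1, h8, by omega, Or.inr ⟨by omega, ?_, by omega, rfl, rfl⟩, ?_⟩), by omega⟩
    · simp (disch := omega) only [xbc_setx, if_true]; omega
    · intro m hm hmn hne hne'
      simp (disch := omega) only [xbc_setx, if_neg hne, if_neg hne']
      first | exact ⟨rfl, rfl⟩ | exact ⟨rfl, trivial⟩ | exact ⟨trivial, rfl⟩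

lemma StepF_det_f (n i : ℕ) (b b' b'' : Tup n) (h : StepF n i b b') (h' : StepF n i b b'') : b' = b'' := by
  apply tup_ext
  intro m hm hmn
  unfold StepF at h h'
  rcases h with ⟨rfl, h, hh⟩ | ⟨h0, rfl, h1, h2, h3, hh⟩ | ⟨h0, h1, h2, h3, hh⟩ <;>
  rcases h' with ⟨g0, g, gg⟩ | ⟨g0, g9, g1, g2, g3, gg⟩ | ⟨g0, g1, g2, g3, gg⟩ <;> try (exfalso; omega)
  · by_cases hm1 : m = 1
    · subst hm1; omega
    · rw [← (hh m (by omega) hmn).1, ← (hh m (by omega) hmn).2]; exact gg m (by omega) hmn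
  · by_cases hm1 : m = i
    · subst hm1; omega
    · rw [← (hh m (by omega) hmn hm1).1, ← (hh m (by omega) hmn hm1).2]; exact gg m (by omega) hmn hm1
  · by_cases hm1 : m = i
    · subst hm1; omega
    · by_cases hm2 : m = i + 1
      · subst hm2; omega
      · rw [← (hh m (by omega) hmn hm1 hm2).1, ← (hh m (by omega) hmn hm1 hm2).2]
        exact gg m (by omega) hmn hm1 hm2

lemma StepF_det_e (n i : ℕ) (b b' b'' : Tup n) (h : StepF n i b' b) (h' : StepF n i b'' b) : b' = b'' := by
  apply tup_ext
  intro m hm hmn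
  unfold StepF at h h'
  rcases h with ⟨rfl, h, hh⟩ | ⟨h0, rfl, h1, h2, h3, hh⟩ | ⟨h0, h1, h2, h3, hh⟩ <;>
  rcases h' with ⟨g0, g, gg⟩ | ⟨g0, g9, g1, g2, g3, gg⟩ | ⟨g0, g1, g2, g3, gg⟩ <;> try (exfalso; omega)
  · by_cases hm1 : m = 1
    · subst hm1; omega
    · rw [(hh m (by omega) hmn).1, (hh m (by omega) hmn).2, (gg m (by omega) hmn).1, (gg m (by omega) hmn).2]
      first | exact ⟨rfl, rfl⟩ | exact ⟨rfl, trivial⟩ | exact ⟨trivial, rfl⟩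
  · by_cases hm1 : m = i
    · subst hm1; omega
    · rw [(hh m (by omega) hmn hm1).1, (hh m (by omega) hmn hm1).2, (gg m (by omega) hmn hm1).1, (gg m (by omega) hmn hm1).2]
      first | exact ⟨rfl, rfl⟩ | exact ⟨rfl, trivial⟩ | exact ⟨trivial, rfl⟩
  · by_cases hm1 : m = i
    · subst hm1; omega
    · by_cases hm2 : m = i + 1
      · subst hm2; omega
      · rw [(hh m (by omega) hmn hm1 hm2).1, (hh m (by omega) hmn hm1 hm2).2, (gg m (by omega) hmn hm1 hm2).1, (gg m (by omega) hmn hm1 hm2).2]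
        first | exact ⟨rfl, rfl⟩ | exact ⟨rfl, trivial⟩ | exact ⟨trivial, rfl⟩

lemma fC_of_step (n l i : ℕ) (hn : 2 ≤ n) (b b' : Tup n) (h : StepF n i b b') (hl : tsum b' ≤ l) :
    fC n l i b = some b' := by
  have hne : fC n l i b ≠ none := by
    intro hc
    unfold StepF at h
    unfold fC at hc
    split_ifs at hc <;> omega
  obtain ⟨b'', hb⟩ := Option.ne_none_iff_exists'.1 hne
  rw [hb, StepF_det_f n i b b' b'' h (fC_step n l i hn b b'' hb).1]

lemma eC_of_step (n l i : ℕ) (hn : 2 ≤ n) (b b' : Tup n) (h : StepF n i b' b) (hl : tsum b' ≤ l) :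
    eC n l i b = some b' := by
  have hne : eC n l i b ≠ none := by
    intro hc
    unfold StepF at h
    unfold eC at hc
    split_ifs at hc <;> omega
  obtain ⟨b'', hb⟩ := Option.ne_none_iff_exists'.1 hne
  rw [hb, StepF_det_e n i b b' b'' h (eC_step n l i hn b b'' hb).1]

lemma psi_step (n l i : ℕ) (b b' : Tup n) (h : StepF n i b b') (hb : tsum b ≤ l)
    (hb' : tsum b' ≤ l) : psiE n l i b' = psiE n l i b + 1 ∧ psiF n l i b = psiF n l i b' + 1 := by
  unfold StepF at h
  unfold psiE psiF x0
  split_ifs <;> omega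

lemma mem_step (n l i : ℕ) (b b' : Tup n) (h : StepF n i b b') (hb' : tsum b' ≤ l) :
    b ∈ BC n l → b' ∈ BC n l := by
  unfold StepF at h
  simp only [BC, memC, Set.mem_ofPred_eq]
  omega

lemma mem_step' (n l i : ℕ) (b b' : Tup n) (h : StepF n i b b') (hb : tsum b ≤ l) :
    b' ∈ BC n l → b ∈ BC n l := by
  unfold StepF at h
  simp only [BC, memC, Set.mem_ofPred_eq]
  omega

lemma fC_none (n l i : ℕ) (hn : 2 ≤ n) (hi : i ≤ n) (b : Tup n) (hb : b ∈ BC n l) :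
    fC n l i b = none ↔ psiF n l i b = 0 := by
  simp only [BC, memC, Set.mem_ofPred_eq] at hb
  unfold psiF fC x0
  split_ifs <;> simp <;> omega

lemma eC_none (n l i : ℕ) (hn : 2 ≤ n) (hi : i ≤ n) (b : Tup n) (hb : b ∈ BC n l) :
    eC n l i b = none ↔ psiE n l i b = 0 := by
  simp only [BC, memC, Set.mem_ofPred_eq] at hb
  unfold psiE eC x0
  split_ifs <;> simp <;> omega

lemma iter_len {α : Type*} (op : α → Option α) (ψ : α → ℕ) (P : α → Prop)
    (h0 : ∀ b, P b → (op b = none ↔ ψ b = 0))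
    (h1 : ∀ b b', P b → op b = some b' → P b' ∧ ψ b = ψ b' + 1) (b : α) (hb : P b) :
    sSup {m | (fun o => Option.bind o op)^[m] (some b) ≠ none} = ψ b := by
  have hnone : ∀ m, (fun o => Option.bind o op)^[m] none = none := by
    intro m
    induction m with
    | zero => rfl
    | succ m ih => rw [Function.iterate_succ_apply]; exact ih
  have key : ∀ m b, P b → ((fun o => Option.bind o op)^[m] (some b) ≠ none ↔ m ≤ ψ b) := by
    intro m
    induction m with
    | zero => intro b _; simp
    | succ m ih =>
      intro b hb
      rw [Function.iterate_succ_apply, Option.bind_some]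
      cases hop : op b with
      | none => rw [hnone]; have := (h0 b hb).1 hop; simp; omega
      | some b' =>
        obtain ⟨hP, hψ⟩ := h1 b b' hb hop
        rw [ih b' hP]; omega
  have : {m | (fun o => Option.bind o op)^[m] (some b) ≠ none} = Set.Iic (ψ b) := by
    ext m
    exact key m b hb
  rw [this, csSup_Iic]

lemma phiC_eq (n l i : ℕ) (hn : 2 ≤ n) (hi : i ≤ n) (b : Tup n) (hb : b ∈ BC n l) :
    phiC n l i b = psiF n l i b := by
  refine iter_len (fC n l i) (psiF n l i) (fun b => b ∈ BC n l) (fC_none n l i hn hi) ?_ b hb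
  intro b b' hb h
  obtain ⟨h1, h2⟩ := fC_step n l i hn b b' h
  exact ⟨mem_step n l i b b' h1 (h2 hb.1) hb, (psi_step n l i b b' h1 hb.1 (h2 hb.1)).2⟩

lemma epsC_eq (n l i : ℕ) (hn : 2 ≤ n) (hi : i ≤ n) (b : Tup n) (hb : b ∈ BC n l) :
    epsC n l i b = psiE n l i b := by
  refine iter_len (eC n l i) (psiE n l i) (fun b => b ∈ BC n l) (eC_none n l i hn hi) ?_ b hb
  intro b b' hb h
  obtain ⟨h1, h2⟩ := eC_step n l i hn b b' h
  exact ⟨mem_step' n l i b' b h1 (h2 hb.1) hb, (psi_step n l i b' b h1 (h2 hb.1) hb.1).1⟩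



abbrev Dom (n l k : ℕ) : Set (Tup n × Tup n) := BC n l ×ˢ BC n k

lemma fTen_left {n l k i : ℕ} (hn : 2 ≤ n) (hi : i ≤ n) {u v : Tup n × Tup n} (hu : u ∈ Dom n l k)
    (h : psiE n k i u.2 < psiF n l i u.1) (h1 : fC n l i u.1 = some v.1) (h2 : v.2 = u.2) :
    fTenC n l k i u = some v := by
  unfold fTenC
  rw [epsC_eq n k i hn hi _ hu.2, phiC_eq n l i hn hi _ hu.1, if_pos h, h1, ← h2]
  rfl

lemma fTen_right {n l k i : ℕ} (hn : 2 ≤ n) (hi : i ≤ n) {u v : Tup n × Tup n} (hu : u ∈ Dom n l k)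
    (h : psiF n l i u.1 ≤ psiE n k i u.2) (h1 : fC n k i u.2 = some v.2) (h2 : v.1 = u.1) :
    fTenC n l k i u = some v := by
  unfold fTenC
  rw [epsC_eq n k i hn hi _ hu.2, phiC_eq n l i hn hi _ hu.1, if_neg (by omega), h1, ← h2]
  rfl

lemma eTen_left {n l k i : ℕ} (hn : 2 ≤ n) (hi : i ≤ n) {u v : Tup n × Tup n} (hu : u ∈ Dom n l k)
    (h : psiE n k i u.2 ≤ psiF n l i u.1) (h1 : eC n l i u.1 = some v.1) (h2 : v.2 = u.2) :
    eTenC n l k i u = some v := by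
  unfold eTenC
  rw [epsC_eq n k i hn hi _ hu.2, phiC_eq n l i hn hi _ hu.1, if_pos h, h1, ← h2]
  rfl

lemma eTen_right {n l k i : ℕ} (hn : 2 ≤ n) (hi : i ≤ n) {u v : Tup n × Tup n} (hu : u ∈ Dom n l k)
    (h : psiF n l i u.1 < psiE n k i u.2) (h1 : eC n k i u.2 = some v.2) (h2 : v.1 = u.1) :
    eTenC n l k i u = some v := by
  unfold eTenC
  rw [epsC_eq n k i hn hi _ hu.2, phiC_eq n l i hn hi _ hu.1, if_neg (by omega), h1, ← h2]
  rfl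

lemma fTen_none {n l k i : ℕ} (hn : 2 ≤ n) (hi : i ≤ n) {u : Tup n × Tup n} (hu : u ∈ Dom n l k)
    (h : psiF n l i u.1 ≤ psiE n k i u.2) (h1 : psiF n k i u.2 = 0) :
    fTenC n l k i u = none := by
  unfold fTenC
  rw [epsC_eq n k i hn hi _ hu.2, phiC_eq n l i hn hi _ hu.1, if_neg (by omega),
    (fC_none n k i hn hi _ hu.2).2 h1]
  rfl

lemma eTen_none_iff {n l k i : ℕ} (hn : 2 ≤ n) (hi : i ≤ n) {u : Tup n × Tup n} (hu : u ∈ Dom n l k) :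
    eTenC n l k i u = none ↔ psiE n l i u.1 = 0 ∧ psiE n k i u.2 ≤ psiF n l i u.1 := by
  unfold eTenC
  rw [epsC_eq n k i hn hi _ hu.2, phiC_eq n l i hn hi _ hu.1]
  split_ifs with h
  · rw [Option.map_eq_none_iff, eC_none n l i hn hi _ hu.1]; tauto
  · rw [Option.map_eq_none_iff, eC_none n k i hn hi _ hu.2]; omega

/-- Analysis of one `f`-step on the tensor product. -/
lemma fTen_step {n l k i : ℕ} (hn : 2 ≤ n) (hi : i ≤ n) {u v : Tup n × Tup n} (hu : u ∈ Dom n l k)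
    (h : fTenC n l k i u = some v) : v ∈ Dom n l k ∧ eTenC n l k i v = some u ∧
      (psiE n k i u.2 < psiF n l i u.1 → psiE n k i v.2 ≤ psiF n l i v.1) ∧
      (psiF n l i u.1 ≤ psiE n k i u.2 → psiF n l i v.1 < psiE n k i v.2) := by
  unfold fTenC at h
  rw [epsC_eq n k i hn hi _ hu.2, phiC_eq n l i hn hi _ hu.1] at h
  split_ifs at h with hc
  · obtain ⟨c, hc1, rfl⟩ := Option.map_eq_some_iff.1 h
    obtain ⟨s1, s2⟩ := fC_step n l i hn _ _ hc1
    have hcl := s2 hu.1.1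
    have hp := psi_step n l i _ _ s1 hu.1.1 hcl
    have hv : (c, u.2) ∈ Dom n l k := ⟨mem_step n l i _ _ s1 hcl hu.1, hu.2⟩
    have hle : psiE n k i u.2 ≤ psiF n l i c := by omega
    refine ⟨hv, eTen_left hn hi hv hle (eC_of_step n l i hn _ _ s1 hu.1.1) rfl, fun _ => hle, ?_⟩
    intro hh; omega
  · obtain ⟨c, hc1, rfl⟩ := Option.map_eq_some_iff.1 h
    obtain ⟨s1, s2⟩ := fC_step n k i hn _ _ hc1
    have hcl := s2 hu.2.1
    have hp := psi_step n k i _ _ s1 hu.2.1 hcl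
    have hv : (u.1, c) ∈ Dom n l k := ⟨hu.1, mem_step n k i _ _ s1 hcl hu.2⟩
    have hlt : psiF n l i u.1 < psiE n k i c := by omega
    refine ⟨hv, eTen_right hn hi hv hlt (eC_of_step n k i hn _ _ s1 hu.2.1) rfl, ?_, fun _ => hlt⟩
    intro hh; omega

lemma eTen_mem {n l k i : ℕ} (hn : 2 ≤ n) {u v : Tup n × Tup n} (hu : u ∈ Dom n l k)
    (h : eTenC n l k i u = some v) : v ∈ Dom n l k := by
  unfold eTenC at h
  split_ifs at h with hc
  · obtain ⟨c, hc1, rfl⟩ := Option.map_eq_some_iff.1 h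
    obtain ⟨s1, s2⟩ := eC_step n l i hn _ _ hc1
    exact ⟨mem_step' n l i _ _ s1 (s2 hu.1.1) hu.1, hu.2⟩
  · obtain ⟨c, hc1, rfl⟩ := Option.map_eq_some_iff.1 h
    obtain ⟨s1, s2⟩ := eC_step n k i hn _ _ hc1
    exact ⟨hu.1, mem_step' n k i _ _ s1 (s2 hu.2.1) hu.2⟩

/-- `w` is obtained from `u` by `N` applications of `op`. -/
def It {α : Type*} (op : α → Option α) : ℕ → α → α → Prop
  | 0, u, w => u = w
  | N+1, u, w => ∃ v, op u = some v ∧ It op N v w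

lemma It_seq {α : Type*} (op : α → Option α) (N : ℕ) : ∀ (g : ℕ → α)
    (_ : ∀ t < N, op (g t) = some (g (t+1))), It op N (g 0) (g N) := by
  induction N with
  | zero => intro g _; rfl
  | succ N ih =>
    intro g h
    exact ⟨g 1, h 0 (by omega), ih (fun t => g (t+1)) (fun t ht => h (t+1) (by omega))⟩

lemma It_add {α : Type*} (op : α → Option α) (M N : ℕ) : ∀ (u v w : α),
    It op M u v → It op N v w → It op (M + N) u w := by
  induction M with
  | zero => intro u v w h h'; cases h; simpa using h'
  | succ M ih =>
    intro u v w ⟨x, hx, h⟩ h'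
    rw [Nat.succ_add]
    exact ⟨x, hx, ih x v w h h'⟩

def MaxIt {α : Type*} (op : α → Option α) (N : ℕ) (u w : α) : Prop := It op N u w ∧ op w = none

lemma MaxIt_uniq {α : Type*} (op : α → Option α) (N : ℕ) : ∀ (N' : ℕ) (u w w' : α),
    MaxIt op N u w → MaxIt op N' u w' → N = N' ∧ w = w' := by
  induction N with
  | zero =>
    intro N' u w w' ⟨h1, h2⟩ ⟨h3, h4⟩
    cases h1
    cases N' with
    | zero => exact ⟨rfl, h3⟩
    | succ N' => obtain ⟨v, hv, _⟩ := h3; rw [h2] at hv; cases hv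
  | succ N ih =>
    intro N' u w w' ⟨⟨v, hv, h1⟩, h2⟩ ⟨h3, h4⟩
    cases N' with
    | zero => cases h3; rw [h4] at hv; cases hv
    | succ N' =>
      obtain ⟨v', hv', h3⟩ := h3
      rw [hv] at hv'; cases hv'
      obtain ⟨rfl, rfl⟩ := ih N' v w w' ⟨h1, h2⟩ ⟨h3, h4⟩
      exact ⟨rfl, rfl⟩

lemma It_trans {α : Type*} (op op' : α → Option α) (P : α → Prop) (ι : α → α)
    (hP : ∀ u v, P u → op u = some v → P v) (hop : ∀ u, P u → Option.map ι (op u) = op' (ι u))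
    (N : ℕ) : ∀ u w, P u → It op N u w → P w ∧ It op' N (ι u) (ι w) := by
  induction N with
  | zero => intro u w hu h; cases h; exact ⟨hu, rfl⟩
  | succ N ih =>
    intro u w hu ⟨v, hv, h⟩
    obtain ⟨a, b⟩ := ih v w (hP u v hu hv) h
    exact ⟨a, ι v, by rw [← hop u hu, hv]; rfl, b⟩

lemma MaxIt_sync {α : Type*} (op op' : α → Option α) (P : α → Prop) (ι : α → α)
    (hP : ∀ u v, P u → op u = some v → P v) (hop : ∀ u, P u → Option.map ι (op u) = op' (ι u))
    (N N' : ℕ) (u w w' : α) (hu : P u) (h : MaxIt op N u w) (h' : MaxIt op' N' (ι u) w') :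
    P w ∧ N = N' ∧ ι w = w' := by
  obtain ⟨a, b⟩ := It_trans op op' P ι hP hop N u w hu h.1
  have : MaxIt op' N (ι u) (ι w) := ⟨b, by rw [← hop w a, h.2]; rfl⟩
  exact ⟨a, MaxIt_uniq op' N N' _ _ _ this h'⟩

lemma syncF {n l k i : ℕ} (hn : 2 ≤ n) (hi : i ≤ n) {ι} (hι : IsIsoC n l k ι) {N N' : ℕ}
    {u w w' : Tup n × Tup n} (hu : u ∈ Dom n l k) (h : MaxIt (fTenC n l k i) N u w)
    (h' : MaxIt (fTenC n k l i) N' (ι u) w') : w ∈ Dom n l k ∧ N = N' ∧ ι w = w' :=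
  MaxIt_sync _ _ (fun u => u ∈ Dom n l k) ι (fun _ _ a b => (fTen_step hn hi a b).1)
    (fun u a => (hι.2 u a i hi).2) N N' u w w' hu h h'

lemma syncE {n l k i : ℕ} (hn : 2 ≤ n) (hi : i ≤ n) {ι} (hι : IsIsoC n l k ι) {N N' : ℕ}
    {u w w' : Tup n × Tup n} (hu : u ∈ Dom n l k) (h : MaxIt (eTenC n l k i) N u w)
    (h' : MaxIt (eTenC n k l i) N' (ι u) w') : w ∈ Dom n l k ∧ N = N' ∧ ι w = w' :=
  MaxIt_sync _ _ (fun u => u ∈ Dom n l k) ι (fun _ _ a b => eTen_mem hn a b)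
    (fun u a => (hι.2 u a i hi).1) N N' u w w' hu h h'

lemma H_itE {n l k i : ℕ} (hn : 2 ≤ n) (hi : i ≤ n) (h0 : i ≠ 0) {ι H} (hH : IsEnergyC n l k ι H)
    {N : ℕ} : ∀ {u w : Tup n × Tup n}, u ∈ Dom n l k → It (eTenC n l k i) N u w → H w = H u := by
  induction N with
  | zero => intro u w hu h; cases h; rfl
  | succ N ih =>
    intro u w hu ⟨v, hv, h⟩
    rw [ih (eTen_mem hn hu hv) h, hH.1 u hu i hi v hv, if_neg h0, add_zero]

lemma H_itF {n l k i : ℕ} (hn : 2 ≤ n) (hi : i ≤ n) (h0 : i ≠ 0) {ι H} (hH : IsEnergyC n l k ι H)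
    {N : ℕ} : ∀ {u w : Tup n × Tup n}, u ∈ Dom n l k → It (fTenC n l k i) N u w → H w = H u := by
  induction N with
  | zero => intro u w hu h; cases h; rfl
  | succ N ih =>
    intro u w hu ⟨v, hv, h⟩
    obtain ⟨a, b, -⟩ := fTen_step hn hi hu hv
    have := hH.1 v a i hi u b
    rw [if_neg h0, add_zero] at this
    rw [ih a h, this]

/-- `f_0` acting on the left factor. -/
def LStep (n l k : ℕ) (u v : Tup n × Tup n) : Prop :=
  fTenC n l k 0 u = some v ∧ psiE n k 0 u.2 < psiF n l 0 u.1
/-- `f_0` acting on the right factor. -/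
def RStep (n l k : ℕ) (u v : Tup n × Tup n) : Prop :=
  fTenC n l k 0 u = some v ∧ psiF n l 0 u.1 ≤ psiE n k 0 u.2

/-- a string of `f_0`: first `α` steps on the left, then `β` on the right. -/
def ItS (n l k : ℕ) : ℕ → ℕ → (Tup n × Tup n) → (Tup n × Tup n) → Prop
  | 0, 0, u, w => u = w
  | 0, β+1, u, w => ∃ v, RStep n l k u v ∧ ItS n l k 0 β v w
  | α+1, β, u, w => ∃ v, LStep n l k u v ∧ ItS n l k α β v w

lemma ItS_R (n l k : ℕ) (N : ℕ) : ∀ (g : ℕ → Tup n × Tup n)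
    (_ : ∀ t < N, RStep n l k (g t) (g (t+1))), ItS n l k 0 N (g 0) (g N) := by
  induction N with
  | zero => intro g _; simp [ItS]
  | succ N ih =>
    intro g h
    rw [ItS]
    exact ⟨g 1, h 0 (by omega), ih (fun t => g (t+1)) (fun t ht => h (t+1) (by omega))⟩

lemma ItS_L (n l k : ℕ) (β : ℕ) (w) (N : ℕ) : ∀ (g : ℕ → Tup n × Tup n)
    (_ : ∀ t < N, LStep n l k (g t) (g (t+1))), ItS n l k 0 β (g N) w → ItS n l k N β (g 0) w := by
  induction N with
  | zero => intro g _ h; exact h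
  | succ N ih =>
    intro g h h'
    rw [ItS]
    exact ⟨g 1, h 0 (by omega), ih (fun t => g (t+1)) (fun t ht => h (t+1) (by omega)) h'⟩

lemma ItS_It {n l k : ℕ} (β α : ℕ) : ∀ u w, ItS n l k α β u w → It (fTenC n l k 0) (α+β) u w := by
  induction α with
  | zero =>
    induction β with
    | zero => intro u w h; simp only [ItS] at h; exact h
    | succ β ih =>
      intro u w h
      rw [ItS] at h
      obtain ⟨v, hv, h⟩ := h
      exact ⟨v, hv.1, ih v w h⟩
  | succ α ih =>
    intro u w h
    rw [ItS] at h
    obtain ⟨v, hv, h⟩ := h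
    rw [Nat.succ_add]
    exact ⟨v, hv.1, ih v w h⟩

lemma ItS_head {n l k α β N : ℕ} {u w : Tup n × Tup n} (h : ItS n l k α β u w) (hN : α + β = N + 1) :
    ∃ v, (0 < α ∧ LStep n l k u v ∧ ItS n l k (α-1) β v w) ∨
      (α = 0 ∧ RStep n l k u v ∧ ItS n l k 0 (β-1) v w) := by
  cases α with
  | succ α => rw [ItS] at h; obtain ⟨v, h1, h2⟩ := h; exact ⟨v, Or.inl ⟨by omega, h1, h2⟩⟩
  | zero =>
    cases β with
    | zero => omega
    | succ β => rw [ItS] at h; obtain ⟨v, h1, h2⟩ := h; exact ⟨v, Or.inr ⟨rfl, h1, h2⟩⟩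

lemma H_ItS {n l k : ℕ} (hn : 2 ≤ n) {ι H} (hι : IsIsoC n l k ι) (hH : IsEnergyC n l k ι H)
    (N : ℕ) : ∀ (α β α' β' : ℕ) (u w w'), u ∈ Dom n l k → α + β = N → α' + β' = N →
    ItS n l k α β u w → ItS n k l α' β' (ι u) w' → H w = H u + (N - α - α' : ℤ) := by
  induction N with
  | zero =>
    intro α β α' β' u w w' hu h1 h2 h h'
    obtain rfl : α = 0 := by omega
    obtain rfl : β = 0 := by omega
    obtain rfl : α' = 0 := by omega
    simp only [ItS] at h
    subst h; simp
  | succ N ih =>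
    intro α β α' β' u w w' hu h1 h2 h h'
    obtain ⟨v, hv⟩ := ItS_head h h1
    obtain ⟨v', hv'⟩ := ItS_head h' h2
    have f1 : fTenC n l k 0 u = some v := by rcases hv with hv | hv; exacts [hv.2.1.1, hv.2.1.1]
    have f2 : fTenC n k l 0 (ι u) = some v' := by rcases hv' with hv | hv; exacts [hv.2.1.1, hv.2.1.1]
    obtain ⟨m1, e1, a1, a2⟩ := fTen_step hn (Nat.zero_le _) hu f1
    have hιu : ι u ∈ Dom n k l := hι.1.mapsTo hu
    obtain ⟨m2, e2, b1, b2⟩ := fTen_step hn (Nat.zero_le _) hιu f2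
    have hvv : ι v = v' := by
      have := (hι.2 u hu 0 (Nat.zero_le _)).2
      rw [f1, f2] at this
      simpa using this
    have hE := hH.1 v m1 0 (Nat.zero_le _) u e1
    rw [hvv, epsC_eq n k 0 hn (Nat.zero_le _) _ m1.2, phiC_eq n l 0 hn (Nat.zero_le _) _ m1.1,
      epsC_eq n l 0 hn (Nat.zero_le _) _ m2.2, phiC_eq n k 0 hn (Nat.zero_le _) _ m2.1, if_pos rfl] at hE
    subst hvv
    rcases hv with ⟨p1, p2, p3⟩ | ⟨p1, p2, p3⟩ <;> rcases hv' with ⟨q1, q2, q3⟩ | ⟨q1, q2, q3⟩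
    · have := ih _ _ _ _ v w w' m1 (by omega) (by omega) p3 q3
      have c1 := a1 p2.2
      have c2 := b1 q2.2
      rw [if_pos ⟨c1, c2⟩] at hE
      omega
    · have := ih _ _ _ _ v w w' m1 (by omega) (by omega) p3 q3
      have c1 := a1 p2.2
      have c2 := b2 q2.2
      rw [if_neg (by omega), if_neg (by omega)] at hE
      omega
    · have := ih _ _ _ _ v w w' m1 (by omega) (by omega) p3 q3
      have c1 := a2 p2.2
      have c2 := b1 q2.2
      rw [if_neg (by omega), if_neg (by omega)] at hE
      omega
    · have := ih _ _ _ _ v w w' m1 (by omega) (by omega) p3 q3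
      have c1 := a2 p2.2
      have c2 := b2 q2.2
      rw [if_neg (by omega), if_pos ⟨c1, c2⟩] at hE
      omega

/-- The path `f_1^max`, `f_0^max`, `e_1^max`. -/
def PhiPath (n l k : ℕ) (α β : ℕ) (u v : Tup n × Tup n) : Prop :=
  ∃ N u1 u2 M, MaxIt (fTenC n l k 1) N u u1 ∧ ItS n l k α β u1 u2 ∧ fTenC n l k 0 u2 = none ∧
    MaxIt (eTenC n l k 1) M u2 v

lemma Phi_sync {n l k : ℕ} (hn : 2 ≤ n) {ι H} (hι : IsIsoC n l k ι) (hH : IsEnergyC n l k ι H)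
    {α β α' β' : ℕ} {u v v'} (hu : u ∈ Dom n l k) (h : PhiPath n l k α β u v)
    (h' : PhiPath n k l α' β' (ι u) v') :
    v ∈ Dom n l k ∧ ι v = v' ∧ α + β = α' + β' ∧ H v = H u + (β - α' : ℤ) := by
  obtain ⟨N, u1, u2, M, h1, h2, h3, h4⟩ := h
  obtain ⟨N', u1', u2', M', h1', h2', h3', h4'⟩ := h'
  obtain ⟨m1, -, rfl⟩ := syncF hn (by omega) hι hu h1 h1'
  obtain ⟨m2, e, rfl⟩ := syncF hn (by omega) hι m1 ⟨ItS_It _ _ _ _ h2, h3⟩ ⟨ItS_It _ _ _ _ h2', h3'⟩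
  obtain ⟨m3, -, rfl⟩ := syncE hn (by omega) hι m2 h4 h4'
  refine ⟨m3, rfl, e, ?_⟩
  rw [H_itE hn (by omega) (by omega) hH m2 h4.1,
    H_ItS hn hι hH (α+β) α β α' β' u1 u2 _ m1 rfl e.symm h2 h2',
    H_itF hn (by omega) (by omega) hH hu h1.1]
  push_cast; ring

/-- Successive maximal `f`-strings. -/
def Chain (n l k : ℕ) : List ℕ → (Tup n × Tup n) → (Tup n × Tup n) → Prop
  | [], u, v => u = v
  | i :: is, u, v => ∃ N w, MaxIt (fTenC n l k i) N u w ∧ Chain n l k is w v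

lemma Chain_sync {n l k : ℕ} (hn : 2 ≤ n) {ι H} (hι : IsIsoC n l k ι) (hH : IsEnergyC n l k ι H)
    (is : List ℕ) (his : ∀ i ∈ is, i ≠ 0 ∧ i ≤ n) : ∀ u v v', u ∈ Dom n l k → Chain n l k is u v →
    Chain n k l is (ι u) v' → v ∈ Dom n l k ∧ ι v = v' ∧ H v = H u := by
  induction is with
  | nil => intro u v v' hu h h'; cases h; cases h'; exact ⟨hu, rfl, rfl⟩
  | cons i is ih =>
    intro u v v' hu ⟨N, w, h1, h2⟩ ⟨N', w', h1', h2'⟩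
    have hi := his i (by simp)
    obtain ⟨m1, -, rfl⟩ := syncF hn hi.2 hι hu h1 h1'
    obtain ⟨a, b, c⟩ := ih (fun j hj => his j (by simp [hj])) w v v' m1 h2 h2'
    exact ⟨a, b, by rw [c, H_itF hn hi.2 hi.1 hH hu h1.1]⟩


/-- the element with `x_1 = a`, `x_2 = b`, `x̄_2 = c`, `x̄_1 = d`. -/
def q4 (n a b c d : ℕ) : Tup n :=
  (setx (setx (fun _ => 0) 1 a) 2 b, setx (setx (fun _ => 0) 2 c) 1 d)

lemma xc_q4 (n a b c d m : ℕ) (h1 : 1 ≤ m) (h2 : m ≤ n) :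
    xc (q4 n a b c d) m = if m = 1 then a else if m = 2 then b else 0 := by
  have h : m - 1 < n := by omega
  have h' : m - 1 + 1 = m := by omega
  simp only [q4, xc, setx, h, h', dite_true]
  split_ifs <;> omega

lemma xbc_q4 (n a b c d m : ℕ) (h1 : 1 ≤ m) (h2 : m ≤ n) :
    xbc (q4 n a b c d) m = if m = 1 then d else if m = 2 then c else 0 := by
  have h : m - 1 < n := by omega
  have h' : m - 1 + 1 = m := by omega
  simp only [q4, xbc, setx, h, h', dite_true]

lemma tsum_q4 (n a b c d : ℕ) (hn : 2 ≤ n) : tsum (q4 n a b c d) = a + b + c + d := by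
  unfold q4
  have e1 := tsum_setx1 (setx (fun _ : Fin n => 0) 1 a) (setx (setx (fun _ => 0) 2 c) 1 d) 2 b (by omega) hn
  have e2 := tsum_setx1 (fun _ : Fin n => 0) (setx (setx (fun _ => 0) 2 c) 1 d) 1 a (by omega) (by omega)
  have e3 := tsum_setx2 (fun _ : Fin n => 0) (setx (fun _ => 0) 2 c) 1 d (by omega) (by omega)
  have e4 := tsum_setx2 (fun _ : Fin n => 0) (fun _ => 0) 2 c (by omega) (by omega)
  have e5 : tsum ((fun _ => 0, fun _ => 0) : Tup n) = 0 := by simp [tsum]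
  have e6 : xc ((fun _ => 0, setx (setx (fun _ => 0) 2 c) 1 d) : Tup n) 1 = 0 := by simp [xc]
  have e7 : xbc ((fun _ => 0, fun _ => 0) : Tup n) 2 = 0 := by simp [xbc]
  have e8 : xbc ((fun _ => 0, fun _ => 0) : Tup n) 1 = 0 := by simp [xbc]
  have e9 : xc ((fun _ => 0, setx (setx (fun _ => 0) 2 c) 1 d) : Tup n) 2 = 0 := by simp [xc]
  rw [xc_setx _ _ _ _ _ (by omega) hn, if_neg (by omega), e9] at e1
  rw [xbc_setx _ _ _ _ _ (by omega) (by omega), if_neg (by omega), e8] at e3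
  omega

lemma q4_eq {n a b c d a' b' c' d' : ℕ} (h1 : a = a') (h2 : b = b') (h3 : c = c') (h4 : d = d') :
    q4 n a b c d = q4 n a' b' c' d' := by subst_vars; rfl

lemma mem_q4 {n l a b c d : ℕ} (hn : 2 ≤ n) (r : ℕ) (h : a + b + c + d + 2 * r = l) :
    q4 n a b c d ∈ BC n l := by
  simp only [BC, memC, Set.mem_ofPred_eq, tsum_q4 n a b c d hn]
  omega

lemma psiE1_q4 (n l a b c d : ℕ) (hn : 2 ≤ n) : psiE n l 1 (q4 n a b c d) = d + (b - c) := by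
  simp only [psiE, if_neg (by omega : ¬ 1 = 0), if_neg (by omega : ¬ 1 = n)]
  simp (disch := omega) [xc_q4, xbc_q4]
lemma psiF1_q4 (n l a b c d : ℕ) (hn : 2 ≤ n) : psiF n l 1 (q4 n a b c d) = a + (c - b) := by
  simp only [psiF, if_neg (by omega : ¬ 1 = 0), if_neg (by omega : ¬ 1 = n)]
  simp (disch := omega) [xc_q4, xbc_q4]
lemma psiE0_q4 (n l a b c d : ℕ) (hn : 2 ≤ n) :
    psiE n l 0 (q4 n a b c d) = (l - (a + b + c + d)) / 2 + (a - d) := by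
  simp only [psiE, if_true, x0, tsum_q4 n a b c d hn]
  simp (disch := omega) [xc_q4, xbc_q4]
lemma psiF0_q4 (n l a b c d : ℕ) (hn : 2 ≤ n) :
    psiF n l 0 (q4 n a b c d) = (l - (a + b + c + d)) / 2 + (d - a) := by
  simp only [psiF, if_true, x0, tsum_q4 n a b c d hn]
  simp (disch := omega) [xc_q4, xbc_q4]

lemma step1_q4 {n a b c d a' b' c' d' : ℕ} (hn : 2 ≤ n)
    (h : (c ≤ b ∧ a' + 1 = a ∧ b' = b + 1 ∧ c' = c ∧ d' = d) ∨
      (b < c ∧ d' = d + 1 ∧ c' + 1 = c ∧ a' = a ∧ b' = b)) :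
    StepF n 1 (q4 n a b c d) (q4 n a' b' c' d') := by
  refine Or.inr (Or.inr ⟨by omega, by omega, ?_, ?_, ?_⟩)
  · rw [tsum_q4 _ _ _ _ _ hn, tsum_q4 _ _ _ _ _ hn]; omega
  · simp (disch := omega) only [xc_q4, xbc_q4]
    simp; omega
  · intro m h1 h2 h3 h4
    simp (disch := omega) only [xc_q4, xbc_q4, if_neg h3, if_neg (by omega : ¬ m = 2)]
    trivial

lemma step0_q4 {n a b c d a' d' : ℕ} (hn : 2 ≤ n)
    (h : (d ≤ a ∧ a' = a + 2 ∧ d' = d) ∨ (a + 1 = d ∧ a' = a + 1 ∧ d' + 1 = d) ∨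
      (a + 2 ≤ d ∧ a' = a ∧ d' + 2 = d)) :
    StepF n 0 (q4 n a b c d) (q4 n a' b c d') := by
  refine Or.inl ⟨rfl, ?_, ?_⟩
  · rw [tsum_q4 _ _ _ _ _ hn, tsum_q4 _ _ _ _ _ hn]
    simp (disch := omega) only [xc_q4, xbc_q4, if_true]
    omega
  · intro m h1 h2
    simp (disch := omega) only [xc_q4, xbc_q4, if_neg (by omega : ¬ m = 1)]
    trivial


/-- The basic path, general version: from the element after the classical strings. -/
lemma phi_exists (n l k p q a c d : ℕ) (hn : 2 ≤ n) (hl : 2 * p + c + d ≤ l)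
    (hk : a + c + d + 2 * q = k) :
    ∃ N, MaxIt (fTenC n l k 1) ((l - 2*p - c - d) + a) (q4 n (l-2*p) 0 0 0, q4 n a c 0 d) N ∧
    PhiPath n l k (p - q) (q + d) (q4 n (l-2*p) 0 0 0, q4 n a c 0 d)
      (q4 n (l - 2 * min p q) 0 0 0,
        q4 n (k - (c + min a (d + 2 * (p - q)))) (c + min a (d + 2 * (p - q))) 0 0) := by
  have hA : MaxIt (fTenC n l k 1) ((l - 2*p - c - d) + a) (q4 n (l-2*p) 0 0 0, q4 n a c 0 d)
      (q4 n (c+d) (l-2*p-c-d) 0 0, q4 n 0 (a+c) 0 d) := by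
    refine ⟨It_add _ _ _ _ (q4 n (c+d) (l-2*p-c-d) 0 0, q4 n a c 0 d) _ ?_ ?_, ?_⟩
    · have := It_seq (fTenC n l k 1) (l - 2*p - c - d) (fun t => (q4 n (l-2*p-t) t 0 0, q4 n a c 0 d)) ?_
      · convert this using 2 <;> exact q4_eq (by omega) (by omega) (by omega) (by omega)
      · intro t ht
        refine fTen_left hn (by omega) ⟨mem_q4 hn p (by omega), mem_q4 hn q (by omega)⟩ ?_ ?_ rfl
        · rw [psiE1_q4 _ _ _ _ _ _ hn, psiF1_q4 _ _ _ _ _ _ hn]; omega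
        · refine fC_of_step n l 1 hn _ _ (step1_q4 hn (by omega)) ?_
          rw [tsum_q4 _ _ _ _ _ hn]; omega
    · have := It_seq (fTenC n l k 1) a (fun t => (q4 n (c+d) (l-2*p-c-d) 0 0, q4 n (a-t) (c+t) 0 d)) ?_
      · convert this using 2 <;> exact q4_eq (by omega) (by omega) (by omega) (by omega)
      · intro t ht
        refine fTen_right hn (by omega) ⟨mem_q4 hn p (by omega), mem_q4 hn q (by omega)⟩ ?_ ?_ rfl
        · rw [psiE1_q4 _ _ _ _ _ _ hn, psiF1_q4 _ _ _ _ _ _ hn]; omega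
        · refine fC_of_step n k 1 hn _ _ (step1_q4 hn (by omega)) ?_
          rw [tsum_q4 _ _ _ _ _ hn]; omega
    · refine fTen_none hn (by omega) ⟨mem_q4 hn p (by omega), mem_q4 hn q (by omega)⟩ ?_ ?_
      · rw [psiE1_q4 _ _ _ _ _ _ hn, psiF1_q4 _ _ _ _ _ _ hn]; omega
      · rw [psiF1_q4 _ _ _ _ _ _ hn]; omega
  refine ⟨_, hA, _, _, (q4 n (c+d+2*(p-q)) (l-2*p-c-d) 0 0, q4 n (d+2*q) (a+c) 0 0), 
    ((a+c) - (c+d+2*(p-q))) + (l-2*p-c-d), hA, ?_, ?_, ?_, ?_⟩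
  · have h1 := ItS_R n l k (q+d) (fun t => (q4 n (c+d+2*(p-q)) (l-2*p-c-d) 0 0, q4 n (2*t-d) (a+c) 0 (d-2*t))) ?_
    · have h2 := ItS_L n l k (q+d) (q4 n (c+d+2*(p-q)) (l-2*p-c-d) 0 0, q4 n (d+2*q) (a+c) 0 0) (p-q)
        (fun t => (q4 n (c+d+2*t) (l-2*p-c-d) 0 0, q4 n 0 (a+c) 0 d)) ?_ ?_
      · exact h2
      · intro t ht
        have hc : psiE n k 0 (q4 n 0 (a+c) 0 d) < psiF n l 0 (q4 n (c+d+2*t) (l-2*p-c-d) 0 0) := by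
          rw [psiE0_q4 _ _ _ _ _ _ hn, psiF0_q4 _ _ _ _ _ _ hn]; omega
        refine ⟨fTen_left hn (by omega) ⟨mem_q4 hn (p-t) (by omega), mem_q4 hn q (by omega)⟩ hc ?_ rfl, hc⟩
        refine fC_of_step n l 0 hn _ _ (step0_q4 hn (by omega)) ?_
        rw [tsum_q4 _ _ _ _ _ hn]; omega
      · convert h1 using 2
        · exact q4_eq (by omega) rfl rfl (by omega)
        · exact q4_eq (by omega) rfl rfl (by omega)
    · intro t ht
      have hc : psiF n l 0 (q4 n (c+d+2*(p-q)) (l-2*p-c-d) 0 0) ≤ psiE n k 0 (q4 n (2*t-d) (a+c) 0 (d-2*t)) := by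
        rw [psiE0_q4 _ _ _ _ _ _ hn, psiF0_q4 _ _ _ _ _ _ hn]; omega
      refine ⟨fTen_right hn (by omega) ⟨mem_q4 hn (min p q) (by omega), 
        mem_q4 hn (if 2*t ≤ d then q+t else q+d-t) (by split_ifs <;> omega)⟩ hc ?_ rfl, hc⟩
      refine fC_of_step n k 0 hn _ _ (step0_q4 hn (by omega)) ?_
      rw [tsum_q4 _ _ _ _ _ hn]; omega
  · refine fTen_none hn (by omega) ⟨mem_q4 hn (min p q) (by omega), mem_q4 hn 0 (by omega)⟩ ?_ ?_
    · rw [psiE0_q4 _ _ _ _ _ _ hn, psiF0_q4 _ _ _ _ _ _ hn]; omega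
    · rw [psiF0_q4 _ _ _ _ _ _ hn]; omega
  · refine It_add _ _ _ _ (q4 n (c+d+2*(p-q)) (l-2*p-c-d) 0 0,
        q4 n (k - (c + min a (d + 2 * (p - q)))) (c + min a (d + 2 * (p - q))) 0 0) _ ?_ ?_
    · have := It_seq (eTenC n l k 1) ((a+c) - (c+d+2*(p-q)))
        (fun t => (q4 n (c+d+2*(p-q)) (l-2*p-c-d) 0 0, q4 n (d+2*q+t) (a+c-t) 0 0)) ?_
      · convert this using 2 <;> exact q4_eq (by omega) (by omega) (by omega) (by omega)
      · intro t ht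
        refine eTen_right hn (by omega) ⟨mem_q4 hn (min p q) (by omega), mem_q4 hn 0 (by omega)⟩ ?_ ?_ rfl
        · rw [psiE1_q4 _ _ _ _ _ _ hn, psiF1_q4 _ _ _ _ _ _ hn]; omega
        · refine eC_of_step n k 1 hn _ _ (step1_q4 hn (by omega)) ?_
          rw [tsum_q4 _ _ _ _ _ hn]; omega
    · have := It_seq (eTenC n l k 1) (l-2*p-c-d)
        (fun t => (q4 n (c+d+2*(p-q)+t) (l-2*p-c-d-t) 0 0, 
          q4 n (k - (c + min a (d + 2 * (p - q)))) (c + min a (d + 2 * (p - q))) 0 0)) ?_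
      · convert this using 2 <;> exact q4_eq (by omega) (by omega) (by omega) (by omega)
      · intro t ht
        refine eTen_left hn (by omega) ⟨mem_q4 hn (min p q) (by omega), mem_q4 hn 0 (by omega)⟩ ?_ ?_ rfl
        · rw [psiE1_q4 _ _ _ _ _ _ hn, psiF1_q4 _ _ _ _ _ _ hn]; omega
        · refine eC_of_step n l 1 hn _ _ (step1_q4 hn (by omega)) ?_
          rw [tsum_q4 _ _ _ _ _ hn]; omega
  · refine (eTen_none_iff hn (by omega) ⟨mem_q4 hn (min p q) (by omega), mem_q4 hn 0 (by omega)⟩).2 ⟨?_, ?_⟩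
    · rw [psiE1_q4 _ _ _ _ _ _ hn]
    · rw [psiE1_q4 _ _ _ _ _ _ hn, psiF1_q4 _ _ _ _ _ _ hn]; omega


def vecL (n : ℕ) (h : ℕ → ℕ) : Tup n := (fun t => h (t+1), fun t => h (2*n - t))

lemma xc_vecL (n : ℕ) (h : ℕ → ℕ) (m : ℕ) (h1 : 1 ≤ m) (h2 : m ≤ n) : xc (vecL n h) m = h m := by
  have h3 : m - 1 < n := by omega
  have h4 : m - 1 + 1 = m := by omega
  simp [xc, vecL, h3, h4]

lemma xbc_vecL (n : ℕ) (h : ℕ → ℕ) (m : ℕ) (h1 : 1 ≤ m) (h2 : m ≤ n) :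
    xbc (vecL n h) m = h (2*n+1-m) := by
  have h3 : m - 1 < n := by omega
  have h4 : 2*n - (m - 1) = 2*n+1-m := by omega
  simp [xbc, vecL, h3, h4]

def hst (n a d j c t m : ℕ) : ℕ :=
  if m = 1 then a else if m = 2*n then d else if m = j then c - t else if m = j+1 then t else 0

def nd (n j : ℕ) : ℕ := if j ≤ n then j else 2*n-j

def VV (n a d j c t : ℕ) : Tup n := vecL n (hst n a d j c t)

lemma hst_j (n a d j c t : ℕ) (h1 : 2 ≤ j) (h2 : j + 2 ≤ 2*n) : hst n a d j c t j = c - t := by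
  unfold hst; rw [if_neg (by omega), if_neg (by omega), if_pos rfl]
lemma hst_j1 (n a d j c t : ℕ) (h1 : 2 ≤ j) (h2 : j + 2 ≤ 2*n) : hst n a d j c t (j+1) = t := by
  unfold hst; rw [if_neg (by omega), if_neg (by omega), if_neg (by omega), if_pos rfl]
lemma hst_z (n a d j c t m : ℕ) (h1 : m ≠ 1) (h2 : m ≠ 2*n) (h3 : m ≠ j) (h4 : m ≠ j + 1) :
    hst n a d j c t m = 0 := by
  unfold hst; rw [if_neg h1, if_neg h2, if_neg h3, if_neg h4]
lemma hst_ne (n a d j c t t' m : ℕ) (h3 : m ≠ j) (h4 : m ≠ j + 1) :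
    hst n a d j c t m = hst n a d j c t' m := by
  unfold hst; rw [if_neg h3, if_neg h3, if_neg h4, if_neg h4]

lemma VV_psiF (n k a d j c t : ℕ) (h1 : 2 ≤ j) (h2 : j + 2 ≤ 2*n) :
    psiF n k (nd n j) (VV n a d j c t) = c - t := by
  have a1 := hst_j n a d j c t h1 h2
  have a2 := hst_j1 n a d j c t h1 h2
  unfold psiF
  rcases lt_trichotomy j n with h | h | h
  · rw [show nd n j = j by unfold nd; rw [if_pos (by omega)], if_neg (by omega), if_neg (by omega)]
    have a3 := hst_z n a d j c t (2*n+1-(j+1)) (by omega) (by omega) (by omega) (by omega)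
    simp (disch := omega) only [VV, xc_vecL, xbc_vecL]
    omega
  · rw [show nd n j = j by unfold nd; rw [if_pos (by omega)], if_neg (by omega), if_pos (by omega)]
    subst h
    simp (disch := omega) only [VV, xc_vecL, xbc_vecL]
    omega
  · rw [show nd n j = 2*n-j by unfold nd; rw [if_neg (by omega)], if_neg (by omega), if_neg (by omega)]
    have a3 := hst_z n a d j c t (2*n-j) (by omega) (by omega) (by omega) (by omega)
    have a4 := hst_z n a d j c t (2*n-j+1) (by omega) (by omega) (by omega) (by omega)
    simp (disch := omega) only [VV, xc_vecL, xbc_vecL]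
    rw [show 2*n+1-(2*n-j+1) = j by omega]
    omega

lemma nd_le (n j : ℕ) (h2 : j + 2 ≤ 2*n) (h1 : 2 ≤ j) : 2 ≤ nd n j ∧ nd n j ≤ n := by
  unfold nd; split_ifs <;> omega

lemma VV_of_step (n a d j c t : ℕ) (b : Tup n) (h1 : 2 ≤ j) (h2 : j + 2 ≤ 2*n)
    (ht : t < c) (s1 : StepF n (nd n j) (VV n a d j c t) b) : b = VV n a d j c (t+1) := by
  have hnd := nd_le n j h2 h1
  have a1 := hst_j n a d j c t h1 h2
  have a2 := hst_j1 n a d j c t h1 h2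
  have a1' := hst_j n a d j c (t+1) h1 h2
  have a2' := hst_j1 n a d j c (t+1) h1 h2
  have ne := hst_ne n a d j c t (t+1)
  apply tup_ext
  intro m hm1 hm2
  unfold StepF at s1
  rcases s1 with s1 | s1 | s1
  · omega
  · obtain ⟨-, e1, e2, e3, -, e4⟩ := s1
    have e5 := e4 m hm1 hm2
    have hj : j = n := by unfold nd at e1; split_ifs at e1 <;> omega
    subst hj
    clear e4
    by_cases hmn : m = j
    · subst hmn
      simp (disch := omega) only [VV, xc_vecL, xbc_vecL] at e2 e3 ⊢
      rw [show 2*m+1-m = m+1 by omega] at *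
      omega
    · have e5 := e5 hmn
      rw [← e5.1, ← e5.2]
      simp (disch := omega) only [VV, xc_vecL, xbc_vecL]
      exact ⟨ne _ (by omega) (by omega), ne _ (by omega) (by omega)⟩
  · obtain ⟨-, e1, -, e2, e4⟩ := s1
    have e5 := e4 m hm1 hm2
    clear e4
    by_cases hjn : j ≤ n
    · have e0 : nd n j = j := by unfold nd; rw [if_pos hjn]
      rw [e0] at e1 e2 e5
      have a3 := hst_z n a d j c t (2*n+1-(j+1)) (by omega) (by omega) (by omega) (by omega)
      have a3' := hst_z n a d j c (t+1) (2*n+1-(j+1)) (by omega) (by omega) (by omega) (by omega)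
      have a4 := ne (2*n+1-j) (by omega) (by omega)
      simp (disch := omega) only [VV, xc_vecL, xbc_vecL] at e2 
      by_cases hmj : m = j
      · subst hmj
        simp (disch := omega) only [VV, xc_vecL, xbc_vecL]
        omega
      · by_cases hmj' : m = j+1
        · subst hmj'
          simp (disch := omega) only [VV, xc_vecL, xbc_vecL]
          omega
        · have e5 := e5 hmj hmj'
          rw [← e5.1, ← e5.2]
          simp (disch := omega) only [VV, xc_vecL, xbc_vecL]
          exact ⟨ne _ (by omega) (by omega), ne _ (by omega) (by omega)⟩
    · have e0 : nd n j = 2*n-j := by unfold nd; rw [if_neg hjn]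
      rw [e0] at e1 e2 e5
      have a3 := hst_z n a d j c t (2*n-j) (by omega) (by omega) (by omega) (by omega)
      have a3' := hst_z n a d j c (t+1) (2*n-j) (by omega) (by omega) (by omega) (by omega)
      have a4 := hst_z n a d j c t (2*n-j+1) (by omega) (by omega) (by omega) (by omega)
      have a4' := hst_z n a d j c (t+1) (2*n-j+1) (by omega) (by omega) (by omega) (by omega)
      simp (disch := omega) only [VV, xc_vecL, xbc_vecL] at e2 
      rw [show 2*n+1-(2*n-j+1) = j by omega, show 2*n+1-(2*n-j) = j+1 by omega] at e2
      by_cases hmj : m = 2*n-j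
      · subst hmj
        simp (disch := omega) only [VV, xc_vecL, xbc_vecL]
        rw [show 2*n+1-(2*n-j) = j+1 by omega]
        omega
      · by_cases hmj' : m = 2*n-j+1
        · subst hmj'
          simp (disch := omega) only [VV, xc_vecL, xbc_vecL]
          rw [show 2*n+1-(2*n-j+1) = j by omega]
          omega
        · have e5 := e5 hmj hmj'
          rw [← e5.1, ← e5.2]
          simp (disch := omega) only [VV, xc_vecL, xbc_vecL]
          exact ⟨ne _ (by omega) (by omega), ne _ (by omega) (by omega)⟩

lemma VV_step (n k a d j c t : ℕ) (hn : 2 ≤ n) (h1 : 2 ≤ j) (h2 : j + 2 ≤ 2*n) (ht : t < c)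
    (hm : VV n a d j c t ∈ BC n k) :
    fC n k (nd n j) (VV n a d j c t) = some (VV n a d j c (t+1)) ∧ VV n a d j c (t+1) ∈ BC n k := by
  have hnd := nd_le n j h2 h1
  have hne : fC n k (nd n j) (VV n a d j c t) ≠ none := by
    rw [Ne, fC_none n k _ hn hnd.2 _ hm, VV_psiF n k a d j c t h1 h2]; omega
  obtain ⟨b, hb⟩ := Option.ne_none_iff_exists'.1 hne
  obtain ⟨s1, s2⟩ := fC_step n k _ hn _ _ hb
  have hbm := mem_step n k _ _ _ s1 (s2 hm.1) hm
  have := VV_of_step n a d j c t b h1 h2 ht s1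
  subst this
  exact ⟨hb, hbm⟩

lemma psiF_q1 (n l i L : ℕ) (h2 : 2 ≤ i) (hi : i ≤ n) : psiF n l i (q4 n L 0 0 0) = 0 := by
  unfold psiF
  rw [if_neg (by omega)]
  split_ifs with h
  · simp (disch := omega) only [xc_q4]; split_ifs <;> omega
  · simp (disch := omega) only [xc_q4, xbc_q4]; split_ifs <;> omega

lemma VV_max (n l k L a d j c : ℕ) (hn : 2 ≤ n) (h1 : 2 ≤ j) (h2 : j + 2 ≤ 2*n)
    (hL : q4 n L 0 0 0 ∈ BC n l) (hm : VV n a d j c 0 ∈ BC n k) :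
    MaxIt (fTenC n l k (nd n j)) c (q4 n L 0 0 0, VV n a d j c 0) (q4 n L 0 0 0, VV n a d j c c) ∧
    VV n a d j c c ∈ BC n k := by
  have hnd := nd_le n j h2 h1
  have hmem : ∀ t, t ≤ c → VV n a d j c t ∈ BC n k := by
    intro t
    induction t with
    | zero => intro _; exact hm
    | succ t ih => intro ht; exact (VV_step n k a d j c t hn h1 h2 (by omega) (ih (by omega))).2
  refine ⟨⟨It_seq _ c (fun t => (q4 n L 0 0 0, VV n a d j c t)) ?_, ?_⟩, hmem c le_rfl⟩
  · intro t ht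
    refine fTen_right hn hnd.2 ⟨hL, hmem t (by omega)⟩ ?_ 
      (VV_step n k a d j c t hn h1 h2 ht (hmem t (by omega))).1 rfl
    rw [psiF_q1 n l _ L hnd.1 hnd.2]; omega
  · refine fTen_none hn hnd.2 ⟨hL, hmem c le_rfl⟩ ?_ ?_
    · rw [psiF_q1 n l _ L hnd.1 hnd.2]; omega
    · rw [VV_psiF n k a d j c c h1 h2]; omega

lemma VV_next (n a d j c : ℕ) (h1 : 2 ≤ j) (h2 : j + 2 ≤ 2*n) : VV n a d j c c = VV n a d (j+1) c 0 := by
  apply tup_ext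
  intro m h3 h4
  simp (disch := omega) only [VV, xc_vecL, xbc_vecL, hst]
  split_ifs <;> omega

lemma VV_first (n a d c : ℕ) (hn : 2 ≤ n) : VV n a d 2 c 0 = q4 n a c 0 d := by
  apply tup_ext
  intro m h3 h4
  simp (disch := omega) only [VV, xc_vecL, xbc_vecL, hst, xc_q4, xbc_q4]
  split_ifs <;> omega

lemma VV_last (n a d c : ℕ) (hn : 2 ≤ n) : VV n a d (2*n-1) c 0 = q4 n a 0 c d := by
  apply tup_ext
  intro m h3 h4
  simp (disch := omega) only [VV, xc_vecL, xbc_vecL, hst, xc_q4, xbc_q4]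
  split_ifs <;> omega

lemma VV_chain (n l k L a d c : ℕ) (hn : 2 ≤ n) (hL : q4 n L 0 0 0 ∈ BC n l) (s : ℕ) : ∀ j, 2 ≤ j →
    j + s = 2*n-1 → VV n a d j c 0 ∈ BC n k →
    Chain n l k ((List.range' j s).map (nd n)) (q4 n L 0 0 0, VV n a d j c 0)
      (q4 n L 0 0 0, VV n a d (2*n-1) c 0) := by
  induction s with
  | zero => intro j h1 h2 h3; simp only [add_zero] at h2; subst h2; rfl
  | succ s ih =>
    intro j h1 h2 h3
    obtain ⟨m1, m2⟩ := VV_max n l k L a d j c hn h1 (by omega) hL h3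
    rw [VV_next n a d j c h1 (by omega)] at m1 m2
    exact ⟨c, _, m1, ih (j+1) (by omega) (by omega) m2⟩

lemma q4_chain (n l k L a d c : ℕ) (hn : 2 ≤ n) (hL : q4 n L 0 0 0 ∈ BC n l)
    (hm : q4 n a c 0 d ∈ BC n k) :
    Chain n l k ((List.range' 2 (2*n-3)).map (nd n)) (q4 n L 0 0 0, q4 n a c 0 d)
      (q4 n L 0 0 0, q4 n a 0 c d) := by
  rw [← VV_first n a d c hn, ← VV_last n a d c hn]
  exact VV_chain n l k L a d c hn hL (2*n-3) 2 le_rfl (by omega) (by rw [VV_first n a d c hn]; exact hm)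

lemma q4_f2 (n l k L a d c : ℕ) (hn : 2 ≤ n) (hL : q4 n L 0 0 0 ∈ BC n l)
    (hm : q4 n a c 0 d ∈ BC n k) :
    ∃ w, MaxIt (fTenC n l k 2) c (q4 n L 0 0 0, q4 n a c 0 d) w := by
  rw [← VV_first n a d c hn] at *
  have := (VV_max n l k L a d 2 c hn le_rfl (by omega) hL hm).1
  rw [show nd n 2 = 2 by unfold nd; rw [if_pos hn]] at this
  exact ⟨_, this⟩

/-- The invariants `c` and `p+q+d`. -/
lemma Wlem {n l k p q a c d p' q' a' c' d' : ℕ} (hn : 2 ≤ n) {ι} (hι : IsIsoC n l k ι)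
    (hl : 2 * p + c + d ≤ l) (hk : a + c + d + 2 * q = k)
    (hl' : 2 * p' + c' + d' ≤ k) (hk' : a' + c' + d' + 2 * q' = l)
    (h : ι (q4 n (l-2*p) 0 0 0, q4 n a c 0 d) = (q4 n (k-2*p') 0 0 0, q4 n a' c' 0 d')) :
    c = c' ∧ p + q + d = p' + q' + d' := by
  have hL : q4 n (l-2*p) 0 0 0 ∈ BC n l := mem_q4 hn p (by omega)
  have hM : q4 n a c 0 d ∈ BC n k := mem_q4 hn q (by omega)
  have hL' : q4 n (k-2*p') 0 0 0 ∈ BC n k := mem_q4 hn p' (by omega)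
  have hM' : q4 n a' c' 0 d' ∈ BC n l := mem_q4 hn q' (by omega)
  obtain ⟨w, hw⟩ := q4_f2 n l k _ a d c hn hL hM
  obtain ⟨w', hw'⟩ := q4_f2 n k l _ a' d' c' hn hL' hM'
  rw [← h] at hw'
  have e1 := (syncF hn hn hι ⟨hL, hM⟩ hw hw').2.1
  obtain ⟨v, hv, -⟩ := phi_exists n l k p q a c d hn hl hk
  obtain ⟨v', hv', -⟩ := phi_exists n k l p' q' a' c' d' hn hl' hk'
  rw [← h] at hv'
  have e2 := (syncF hn (by omega) hι ⟨hL, hM⟩ hv hv').2.1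
  omega

lemma classify {n l k : ℕ} (hn : 2 ≤ n) {u : Tup n × Tup n} (hu : u ∈ Dom n l k)
    (h : ∀ i, 1 ≤ i → i ≤ n → eTenC n l k i u = none) :
    ∃ p q a c d, u = (q4 n (l-2*p) 0 0 0, q4 n a c 0 d) ∧ 2 * p + c + d ≤ l ∧ a + c + d + 2 * q = k := by
  have hh : ∀ i, 1 ≤ i → i ≤ n → psiE n l i u.1 = 0 ∧ psiE n k i u.2 ≤ psiF n l i u.1 :=
    fun i h1 h2 => (eTen_none_iff hn h2 hu).1 (h i h1 h2)
  have e1 : ∀ m, 1 ≤ m → m ≤ n → xbc u.1 m = 0 := by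
    intro m h1 h2
    have := (hh m h1 h2).1
    unfold psiE at this
    rw [if_neg (by omega)] at this
    split_ifs at this with hm
    · rw [hm]; exact this
    · omega
  have e2 : ∀ m, 2 ≤ m → m ≤ n → xc u.1 m = 0 := by
    intro m h1 h2
    obtain ⟨r, rfl⟩ : ∃ r, m = r + 1 := ⟨m-1, by omega⟩
    have := (hh r (by omega) (by omega)).1
    have e3 := e1 (r+1) (by omega) h2
    unfold psiE at this
    rw [if_neg (by omega), if_neg (by omega)] at this
    omega
  have u1 : u.1 = q4 n (xc u.1 1) 0 0 0 := by
    apply tup_ext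
    intro m h1 h2
    simp (disch := omega) only [xc_q4, xbc_q4]
    refine ⟨?_, by rw [e1 m h1 h2]; split_ifs <;> rfl⟩
    split_ifs with h3 h4
    · rw [h3]
    · exact e2 m (by omega) h2
    · exact e2 m (by omega) h2
  have g : ∀ i, 2 ≤ i → i ≤ n → psiE n k i u.2 = 0 := by
    intro i h1 h2
    have := (hh i (by omega) h2).2
    rw [u1, psiF_q1 n l i _ h1 h2] at this
    omega
  have e3 : ∀ m, 2 ≤ m → m ≤ n → xbc u.2 m = 0 := by
    intro m h1 h2
    have := g m h1 h2
    unfold psiE at this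
    rw [if_neg (by omega)] at this
    split_ifs at this with hm
    · rw [hm]; exact this
    · omega
  have e4 : ∀ m, 3 ≤ m → m ≤ n → xc u.2 m = 0 := by
    intro m h1 h2
    obtain ⟨r, rfl⟩ : ∃ r, m = r + 1 := ⟨m-1, by omega⟩
    have := g r (by omega) (by omega)
    have e5 := e3 (r+1) (by omega) h2
    unfold psiE at this
    rw [if_neg (by omega), if_neg (by omega)] at this
    omega
  have u2 : u.2 = q4 n (xc u.2 1) (xc u.2 2) 0 (xbc u.2 1) := by
    apply tup_ext
    intro m h1 h2
    simp (disch := omega) only [xc_q4, xbc_q4]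
    constructor
    · split_ifs with h3 h4
      · rw [h3]
      · rw [h4]
      · exact e4 m (by omega) h2
    · split_ifs with h3 h4
      · rw [h3]
      · exact e3 m (by omega) h2
      · exact e3 m (by omega) h2
  have key := (hh 1 le_rfl (by omega)).2
  have m1 := hu.1
  have m2 := hu.2
  rw [u1] at m1
  rw [u2] at m2
  simp only [BC, memC, Set.mem_ofPred_eq, tsum_q4 n _ _ _ _ hn] at m1 m2
  rw [u1, u2, psiE1_q4 _ _ _ _ _ _ hn, psiF1_q4 _ _ _ _ _ _ hn] at key
  refine ⟨(l - xc u.1 1)/2, (k - (xc u.2 1 + xc u.2 2 + 0 + xbc u.2 1))/2, xc u.2 1, xc u.2 2, xbc u.2 1, ?_, by omega, by omega⟩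
  refine Prod.ext ?_ u2
  rw [show l - 2*((l - xc u.1 1)/2) = xc u.1 1 by omega]
  exact u1



lemma psi_exists (n l k C : ℕ) (hn : 2 ≤ n) (hk : C ≤ k) :
    PhiPath n l k 0 C (q4 n l 0 0 0, q4 n (k-C) 0 C 0) (q4 n l 0 0 0, q4 n k 0 0 0) := by
  refine ⟨l + (C + (k-C)), (q4 n 0 l 0 0, q4 n 0 (k-C) 0 C), (q4 n 0 l 0 0, q4 n C (k-C) 0 0),
    (k-C) + l, ⟨It_add _ _ _ _ (q4 n 0 l 0 0, q4 n (k-C) 0 C 0) _ ?_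
      (It_add _ _ _ _ (q4 n 0 l 0 0, q4 n (k-C) 0 0 C) _ ?_ ?_), ?_⟩, ?_, ?_,
      ⟨It_add _ _ _ _ (q4 n 0 l 0 0, q4 n k 0 0 0) _ ?_ ?_, ?_⟩⟩
  · have := It_seq (fTenC n l k 1) l (fun t => (q4 n (l-t) t 0 0, q4 n (k-C) 0 C 0)) ?_
    · convert this using 2 <;> exact q4_eq (by omega) (by omega) (by omega) (by omega)
    · intro t ht
      refine fTen_left hn (by omega) ⟨mem_q4 hn 0 (by omega), mem_q4 hn 0 (by omega)⟩ ?_ ?_ rfl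
      · rw [psiE1_q4 _ _ _ _ _ _ hn, psiF1_q4 _ _ _ _ _ _ hn]; omega
      · refine fC_of_step n l 1 hn _ _ (step1_q4 hn (by omega)) ?_
        rw [tsum_q4 _ _ _ _ _ hn]; omega
  · have := It_seq (fTenC n l k 1) C (fun t => (q4 n 0 l 0 0, q4 n (k-C) 0 (C-t) t)) ?_
    · convert this using 2 <;> exact q4_eq (by omega) (by omega) (by omega) (by omega)
    · intro t ht
      refine fTen_right hn (by omega) ⟨mem_q4 hn 0 (by omega), mem_q4 hn 0 (by omega)⟩ ?_ ?_ rfl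
      · rw [psiE1_q4 _ _ _ _ _ _ hn, psiF1_q4 _ _ _ _ _ _ hn]; omega
      · refine fC_of_step n k 1 hn _ _ (step1_q4 hn (by omega)) ?_
        rw [tsum_q4 _ _ _ _ _ hn]; omega
  · have := It_seq (fTenC n l k 1) (k-C) (fun t => (q4 n 0 l 0 0, q4 n (k-C-t) t 0 C)) ?_
    · convert this using 2 <;> exact q4_eq (by omega) (by omega) (by omega) (by omega)
    · intro t ht
      refine fTen_right hn (by omega) ⟨mem_q4 hn 0 (by omega), mem_q4 hn 0 (by omega)⟩ ?_ ?_ rfl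
      · rw [psiE1_q4 _ _ _ _ _ _ hn, psiF1_q4 _ _ _ _ _ _ hn]; omega
      · refine fC_of_step n k 1 hn _ _ (step1_q4 hn (by omega)) ?_
        rw [tsum_q4 _ _ _ _ _ hn]; omega
  · refine fTen_none hn (by omega) ⟨mem_q4 hn 0 (by omega), mem_q4 hn 0 (by omega)⟩ ?_ ?_
    · rw [psiE1_q4 _ _ _ _ _ _ hn, psiF1_q4 _ _ _ _ _ _ hn]; omega
    · rw [psiF1_q4 _ _ _ _ _ _ hn]; omega
  · have h1 := ItS_R n l k C (fun t => (q4 n 0 l 0 0, q4 n (2*t-C) (k-C) 0 (C-2*t))) ?_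
    · convert h1 using 2 <;> exact q4_eq (by omega) (by omega) (by omega) (by omega)
    · intro t ht
      have hc : psiF n l 0 (q4 n 0 l 0 0) ≤ psiE n k 0 (q4 n (2*t-C) (k-C) 0 (C-2*t)) := by
        rw [psiE0_q4 _ _ _ _ _ _ hn, psiF0_q4 _ _ _ _ _ _ hn]; omega
      refine ⟨fTen_right hn (by omega) ⟨mem_q4 hn 0 (by omega), 
        mem_q4 hn (if 2*t ≤ C then t else C-t) (by split_ifs <;> omega)⟩ hc ?_ rfl, hc⟩
      refine fC_of_step n k 0 hn _ _ (step0_q4 hn (by omega)) ?_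
      rw [tsum_q4 _ _ _ _ _ hn]; omega
  · refine fTen_none hn (by omega) ⟨mem_q4 hn 0 (by omega), mem_q4 hn 0 (by omega)⟩ ?_ ?_
    · rw [psiE0_q4 _ _ _ _ _ _ hn, psiF0_q4 _ _ _ _ _ _ hn]; omega
    · rw [psiF0_q4 _ _ _ _ _ _ hn]; omega
  · have := It_seq (eTenC n l k 1) (k-C) (fun t => (q4 n 0 l 0 0, q4 n (C+t) (k-C-t) 0 0)) ?_
    · convert this using 2 <;> exact q4_eq (by omega) (by omega) (by omega) (by omega)
    · intro t ht
      refine eTen_right hn (by omega) ⟨mem_q4 hn 0 (by omega), mem_q4 hn 0 (by omega)⟩ ?_ ?_ rfl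
      · rw [psiE1_q4 _ _ _ _ _ _ hn, psiF1_q4 _ _ _ _ _ _ hn]; omega
      · refine eC_of_step n k 1 hn _ _ (step1_q4 hn (by omega)) ?_
        rw [tsum_q4 _ _ _ _ _ hn]; omega
  · have := It_seq (eTenC n l k 1) l (fun t => (q4 n t (l-t) 0 0, q4 n k 0 0 0)) ?_
    · convert this using 2 <;> exact q4_eq (by omega) (by omega) (by omega) (by omega)
    · intro t ht
      refine eTen_left hn (by omega) ⟨mem_q4 hn 0 (by omega), mem_q4 hn 0 (by omega)⟩ ?_ ?_ rfl
      · rw [psiE1_q4 _ _ _ _ _ _ hn, psiF1_q4 _ _ _ _ _ _ hn]; omega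
      · refine eC_of_step n l 1 hn _ _ (step1_q4 hn (by omega)) ?_
        rw [tsum_q4 _ _ _ _ _ hn]; omega
  · refine (eTen_none_iff hn (by omega) ⟨mem_q4 hn 0 (by omega), mem_q4 hn 0 (by omega)⟩).2 ⟨?_, ?_⟩
    · rw [psiE1_q4 _ _ _ _ _ _ hn]
    · rw [psiE1_q4 _ _ _ _ _ _ hn, psiF1_q4 _ _ _ _ _ _ hn]; omega

lemma psiE_q3 (n l i L c d : ℕ) (h2 : 2 ≤ i) (hi : i ≤ n) : psiE n l i (q4 n L c 0 d) = 0 := by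
  unfold psiE
  rw [if_neg (by omega)]
  split_ifs with h
  · simp (disch := omega) only [xbc_q4]; split_ifs <;> omega
  · simp (disch := omega) only [xc_q4, xbc_q4]; split_ifs <;> omega

lemma highest_q4 {n l k p q a c d : ℕ} (hn : 2 ≤ n) (hl : 2 * p + c + d ≤ l)
    (hk : a + c + d + 2 * q = k) (i : ℕ) (h1 : 1 ≤ i) (h2 : i ≤ n) :
    eTenC n l k i (q4 n (l-2*p) 0 0 0, q4 n a c 0 d) = none := by
  refine (eTen_none_iff hn h2 ⟨mem_q4 hn p (by omega), mem_q4 hn q (by omega)⟩).2 ?_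
  by_cases hi : i = 1
  · subst hi
    rw [psiE1_q4 _ _ _ _ _ _ hn, psiE1_q4 _ _ _ _ _ _ hn, psiF1_q4 _ _ _ _ _ _ hn]; omega
  · rw [psiE_q3 n l i _ 0 0 (by omega) h2, psiE_q3 n k i _ c d (by omega) h2]
    simp

lemma iota_form {n l k : ℕ} (hn : 2 ≤ n) {ι} (hι : IsIsoC n l k ι) {u} (hu : u ∈ Dom n l k)
    (h : ∀ i, 1 ≤ i → i ≤ n → eTenC n l k i u = none) :
    ∃ p q a c d, ι u = (q4 n (k-2*p) 0 0 0, q4 n a c 0 d) ∧ 2 * p + c + d ≤ k ∧ a + c + d + 2 * q = l := by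
  refine classify hn (hι.1.mapsTo hu) ?_
  intro i h1 h2
  rw [← (hι.2 u hu i h2).1, h i h1 h2]
  rfl

lemma Hs0 {n l k C : ℕ} (hn : 2 ≤ n) {ι H} (hι : IsIsoC n l k ι) (hH : IsEnergyC n l k ι H)
    (h1 : C ≤ l) (h2 : C ≤ k) :
    H (q4 n l 0 0 0, q4 n k 0 0 0) = H (q4 n l 0 0 0, q4 n (k-C) C 0 0) + C := by
  have hL : q4 n l 0 0 0 ∈ BC n l := mem_q4 hn 0 (by omega)
  have hK : q4 n k 0 0 0 ∈ BC n k := mem_q4 hn 0 (by omega)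
  have hM : q4 n (k-C) C 0 0 ∈ BC n k := mem_q4 hn 0 (by omega)
  have hu : (q4 n l 0 0 0, q4 n (k-C) C 0 0) ∈ Dom n l k := ⟨hL, hM⟩
  obtain ⟨p', q', a', c', d', e, e1, e2⟩ := iota_form hn hι hu
    (highest_q4 (p := 0) (q := 0) hn (by omega) (by omega))
  obtain ⟨w1, w2⟩ := Wlem (p := 0) (q := 0) hn hι (by omega) (by omega) e1 e2 e
  obtain ⟨rfl, rfl, rfl, rfl, rfl⟩ : p' = 0 ∧ q' = 0 ∧ d' = 0 ∧ C = c' ∧ a' = l - C := by omega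
  have hM' : q4 n (l-C) C 0 0 ∈ BC n l := mem_q4 hn 0 (by omega)
  have c1 := q4_chain n l k l (k-C) 0 C hn hL hM
  have c2 := q4_chain n k l k (l-C) 0 C hn hK hM'
  simp only [Nat.mul_zero, Nat.sub_zero] at e
  rw [← e] at c2
  obtain ⟨m, e3, e4⟩ := Chain_sync hn hι hH _ (by
    intro i hi
    obtain ⟨j, hj, rfl⟩ := List.mem_map.1 hi
    rw [List.mem_range'_1] at hj
    have := nd_le n j (by omega) (by omega)
    omega) _ _ _ hu c1 c2
  have p2 := psi_exists n k l C hn h1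
  rw [← e3] at p2
  have := (Phi_sync hn hι hH m (psi_exists n l k C hn h2) p2).2.2.2
  rw [this, e4]; push_cast; ring

lemma uvec_q4 (n l : ℕ) : uvec n l = q4 n l 0 0 0 := by
  refine Prod.ext (funext fun t => ?_) (funext fun t => ?_)
  · simp only [uvec, q4, setx]; split_ifs <;> omega
  · simp only [uvec, q4, setx]; split_ifs <;> omega
lemma u2vec_q4 (n l : ℕ) : u2vec n l = q4 n 0 l 0 0 := by
  refine Prod.ext (funext fun t => ?_) (funext fun t => ?_)
  · simp only [u2vec, q4, setx]; split_ifs <;> omega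
  · simp only [u2vec, q4, setx]; split_ifs <;> omega

lemma Hnorm {n l k : ℕ} (hn : 2 ≤ n) {ι H} (hι : IsIsoC n l k ι) (hH : IsEnergyC n l k ι H) :
    H (q4 n l 0 0 0, q4 n k 0 0 0) = ((min l k : ℕ) : ℤ) := by
  rw [Hs0 hn hι hH (min_le_left l k) (min_le_right l k)]
  have h0 := hH.2
  rw [uvec_q4, u2vec_q4] at h0
  have := It_seq (eTenC n l k 1) (k - min l k) (fun t => (q4 n l 0 0 0, q4 n t (k-t) 0 0)) ?_
  · have h2 := H_itE hn (by omega) (by omega) hH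
      ⟨mem_q4 hn 0 (by omega), mem_q4 hn 0 (by omega)⟩ this
    simp only [Nat.sub_zero] at h2
    rw [h0, show k - (k - min l k) = min l k by omega] at h2
    rw [h2, zero_add]
  · intro t ht
    refine eTen_right hn (by omega) ⟨mem_q4 hn 0 (by omega), mem_q4 hn 0 (by omega)⟩ ?_ ?_ rfl
    · rw [psiE1_q4 _ _ _ _ _ _ hn, psiF1_q4 _ _ _ _ _ _ hn]; omega
    · refine eC_of_step n k 1 hn _ _ (step1_q4 hn (by omega)) ?_
      rw [tsum_q4 _ _ _ _ _ hn]; omega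

lemma min_bd {l p q a c d : ℕ} (hl : 2 * p + c + d ≤ l) :
    2 * min p q + (c + min a (d + 2 * (p - q))) + 0 ≤ l := by
  have h1 := min_le_right a (d + 2 * (p - q))
  have h2 : min p q + (p - q) = p := by omega
  omega
lemma min_bd2 {k q a c d : ℕ} (hk : a + c + d + 2 * q = k) (X : ℕ) :
    k - (c + min a X) + (c + min a X) + 0 + 2 * 0 = k := by
  have h1 := min_le_left a X
  omega

lemma main_core {n l k p q a c d p' q' a' c' d' : ℕ} (hn : 2 ≤ n) {ι H} (hι : IsIsoC n l k ι)
    (hH : IsEnergyC n l k ι H)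
    (hl : 2 * p + c + d ≤ l) (hk : a + c + d + 2 * q = k)
    (hl' : 2 * p' + c' + d' ≤ k) (hk' : a' + c' + d' + 2 * q' = l)
    (h : ι (q4 n (l-2*p) 0 0 0, q4 n a c 0 d) = (q4 n (k-2*p') 0 0 0, q4 n a' c' 0 d'))
    (hpq : p = 0 ∨ q = 0) :
    (p' = 0 ∨ q' = 0) ∧ c = c' ∧ p + q + d = p' + q' + d' ∧
    min a (d+2*p) = min a' (d'+2*p') ∧
    H (q4 n (l-2*p) 0 0 0, q4 n a c 0 d) + (c + min a (d+2*p) + (p+q+d) : ℕ)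
      = ((min l k + p + p' : ℕ) : ℤ) := by
  obtain ⟨rfl, hs⟩ := Wlem hn hι hl hk hl' hk' h
  obtain ⟨-, -, ph⟩ := phi_exists n l k p q a c d hn hl hk
  obtain ⟨-, -, ph'⟩ := phi_exists n k l p' q' a' c d' hn hl' hk'
  rw [← h] at ph'
  obtain ⟨m, e1, -, e2⟩ := Phi_sync hn hι hH ⟨mem_q4 hn p (by omega), mem_q4 hn q (by omega)⟩ ph ph'
  obtain ⟨w1, w2⟩ := Wlem (q := 0) (q' := 0) hn hι (min_bd hl) (min_bd2 hk _) (min_bd hl') (min_bd2 hk' _) e1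
  have hw : min p q = min p' q' := by simpa using w2
  clear e1 ph ph' h
  have hz : min p q = 0 := by omega
  have hz' : p' = 0 ∨ q' = 0 := by omega
  have f1 : min a (d + 2 * (p - q)) = min a (d+2*p) := by
    rcases hpq with rfl | rfl
    · rw [Nat.zero_sub]
    · rw [Nat.sub_zero]
  have f2 : min a' (d' + 2 * (p' - q')) = min a' (d'+2*p') := by
    rcases hz' with rfl | rfl
    · rw [Nat.zero_sub]
    · rw [Nat.sub_zero]
  rw [f1, f2] at w1
  have hm : min a (d+2*p) = min a' (d'+2*p') := Nat.add_left_cancel w1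
  refine ⟨hz', rfl, hs, hm, ?_⟩
  rw [hz, f1, Nat.mul_zero, Nat.sub_zero] at e2
  have b1 := min_le_right a (d + 2 * p)
  have b2 := min_le_left a (d + 2 * p)
  have := Hs0 (C := c + min a (d + 2 * p)) hn hι hH (by omega) (by omega)
  rw [e2, Hnorm hn hι hH] at this
  clear hm w1 f1 f2 hw e2 hz
  generalize min a (d + 2 * p) = M at *
  generalize min l k = K at *
  have e4 : p' - q' = p' := by omega
  rw [e4] at this
  push_cast at this ⊢
  linarith

lemma foldr_app (L : List (List ℕ)) : L.foldr (· ++ ·) [] = L.flatten := by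
  induction L with
  | nil => rfl
  | cons a L ih => simp [ih]

lemma coreWord_q4 (n a c d : ℕ) (hn : 2 ≤ n) : coreWord n (q4 n a c 0 d) =
    List.replicate a 1 ++ List.replicate c 2 ++ List.replicate d (2*n) := by
  obtain ⟨m, rfl⟩ : ∃ m, n = m + 2 := ⟨n-2, by omega⟩
  unfold coreWord
  rw [foldr_app, foldr_app, List.finRange_succ, List.finRange_succ]
  have z1 : ((List.finRange m).map ((fun i : Fin (m+2) => List.replicate ((q4 (m+2) a c 0 d).1 i) ((i:ℕ)+1)) ∘ Fin.succ ∘ Fin.succ)).flatten = [] := by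
    rw [List.flatten_eq_nil_iff]
    intro x hx
    obtain ⟨i, -, rfl⟩ := List.mem_map.1 hx
    simp [q4, setx]
  have z2 : ((List.finRange m).reverse.map ((fun i : Fin (m+2) => List.replicate ((q4 (m+2) a c 0 d).2 i) (bar (m+2) ((i:ℕ)+1))) ∘ Fin.succ ∘ Fin.succ)).flatten = [] := by
    rw [List.flatten_eq_nil_iff]
    intro x hx
    obtain ⟨i, -, rfl⟩ := List.mem_map.1 hx
    simp [q4, setx]
  simp only [List.map_cons, List.map_map, List.reverse_cons, List.map_append, List.flatten_cons,
    List.flatten_append, List.map_nil, List.flatten_nil, List.append_nil, List.map_reverse] at z1 z2 ⊢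
  erw [z1, z2]
  simp [q4, setx, bar]

lemma x0_q4 {n l a b c d : ℕ} (hn : 2 ≤ n) (r : ℕ) (h : a + b + c + d + 2 * r = l) :
    x0 l (q4 n a b c d) = r := by
  unfold x0; rw [tsum_q4 _ _ _ _ _ hn]; omega

lemma rowWord_q4 {n l a c d : ℕ} (hn : 2 ≤ n) (r : ℕ) (h : a + c + d + 2 * r = l) :
    rowWordC n l (q4 n a c 0 d) = List.replicate r 0 ++
      (List.replicate a 1 ++ List.replicate c 2 ++ List.replicate d (2*n)) ++
      List.replicate r (2*n+1) := by
  unfold rowWordC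
  rw [x0_q4 hn r (by omega), coreWord_q4 _ _ _ _ hn]; rfl

lemma rowWord_q1 {n l p : ℕ} (hn : 2 ≤ n) (h : 2 * p ≤ l) :
    rowWordC n l (q4 n (l-2*p) 0 0 0) = List.replicate p 0 ++ List.replicate (l-2*p) 1 ++
      List.replicate p (2*n+1) := by
  rw [rowWord_q4 hn p (by omega)]; simp

/-- **Proposition 4.1.**  If `b₁ ⊗ b₂ ∈ B_l ⊗ B_k` is a `U_q(C_n)` highest element and the
word of `b₁` or of `b₂` has no letter `0`, then writing `ι(b₁ ⊗ b₂) = b₂' ⊗ b₁'`, the word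
of `b₂'` or of `b₁'` has no letter `0`, the column insertions `(𝕋(b₂) → 𝕋(b₁))` and
`(𝕋(b₁') → 𝕋(b₂'))` give a common tableau, and `H(b₁ ⊗ b₂)` equals the length of the first
row of that tableau minus `max(l,k)`. -/
theorem proposition_4_1
    (n l k : ℕ) (hn : 2 ≤ n) (hl : 1 ≤ l) (hk : 1 ≤ k)
    (ι : Tup n × Tup n → Tup n × Tup n) (hι : IsIsoC n l k ι)
    (H : Tup n × Tup n → ℤ) (hH : IsEnergyC n l k ι H)
    (b1 b2 : Tup n) (hb1 : b1 ∈ BC n l) (hb2 : b2 ∈ BC n k)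
    (hhigh : ∀ i, 1 ≤ i → i ≤ n → eTenC n l k i (b1, b2) = none)
    (h0 : x0 l b1 = 0 ∨ x0 k b2 = 0)
    (b1' b2' : Tup n) (hval : ι (b1, b2) = (b2', b1')) :
    (x0 k b2' = 0 ∨ x0 l b1' = 0) ∧
    insertWord n (rowWordC n k b2) (rowCols (rowWordC n l b1)) =
      insertWord n (rowWordC n l b1') (rowCols (rowWordC n k b2')) ∧
    H (b1, b2) =
      ((insertWord n (rowWordC n k b2) (rowCols (rowWordC n l b1))).length : ℤ)
        - ((max l k : ℕ) : ℤ) := by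
  have hu : (b1, b2) ∈ Dom n l k := ⟨hb1, hb2⟩
  obtain ⟨p, q, a, c, d, e, g1, g2⟩ := classify hn hu hhigh
  obtain ⟨p', q', a', c', d', e', g1', g2'⟩ := iota_form hn hι hu hhigh
  rw [hval] at e'
  obtain ⟨rfl, rfl⟩ := Prod.mk.inj e
  obtain ⟨rfl, rfl⟩ := Prod.mk.inj e'
  rw [x0_q4 hn p (by omega), x0_q4 hn q (by omega)] at h0
  obtain ⟨r1, rfl, r3, r4, r5⟩ := main_core hn hι hH g1 g2 g1' g2' hval h0
  rw [x0_q4 hn p' (by omega), x0_q4 hn q' (by omega), rowWord_q1 hn (by omega),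
    rowWord_q1 hn (by omega), rowWord_q4 hn q g2, rowWord_q4 hn q' g2']
  obtain ⟨t1, t2⟩ := tabSame n l k p q d c a p' q' d' a' hn h0 r1 (by omega) (by omega) (by omega)
    (by omega) r3 r4
  refine ⟨r1, t1, ?_⟩
  push_cast at r5 t2 ⊢
  omega


end KTT
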